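/- arXiv:1301.3188 — 2 statements merged into one kernel-verified Lean document; each statement's English description precedes it below -/
import Mathlib

section
/- For every n ≥ 4, the number s_n of simple permutations of length n in 𝒜 equals (3^{n−3} + (−1)^n)/2; equivalently, 2·s_n = 3^{n−3} + (−1)^n. In particular s_4 = 2, s_5 = 4, s_6 = 14, s_7 = 40, s_8 = 122, s_9 = 364. -/
/-- `σ` is contained in `π` as a pattern. -/
def Contains {k n : ℕ} (σ : Equiv.Perm (Fin k)) (π : Equiv.Perm (Fin n)) : Prop :=
  ∃ f : Fin k → Fin n, StrictMono f ∧ ∀ i j : Fin k, σ i < σ j ↔ π (f i) < π (f j)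

/-- `π` avoids the pattern `σ`. -/
def Avoids {k n : ℕ} (σ : Equiv.Perm (Fin k)) (π : Equiv.Perm (Fin n)) : Prop :=
  ¬ Contains σ π

/-- The permutation 4231 (0-indexed values). -/
noncomputable def p4231 : Equiv.Perm (Fin 4) := Equiv.ofBijective ![3,1,2,0] (by decide)

/-- The permutation 35142 (0-indexed values). -/
noncomputable def p35142 : Equiv.Perm (Fin 5) := Equiv.ofBijective ![2,4,0,3,1] (by decide)

/-- The permutation 42513 (0-indexed values). -/
noncomputable def p42513 : Equiv.Perm (Fin 5) := Equiv.ofBijective ![3,1,4,0,2] (by decide)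

/-- The permutation 351624 (0-indexed values). -/
noncomputable def p351624 : Equiv.Perm (Fin 6) := Equiv.ofBijective ![2,4,0,5,1,3] (by decide)

/-- Membership in the class 𝒜 = Av(4231, 35142, 42513, 351624). -/
def InA {n : ℕ} (π : Equiv.Perm (Fin n)) : Prop :=
  Avoids p4231 π ∧ Avoids p35142 π ∧ Avoids p42513 π ∧ Avoids p351624 π

/-- `s` is an interval of `π`: a set of consecutive positions whose image
under `π` is a set of consecutive values. -/
def IsPermInterval {n : ℕ} (π : Equiv.Perm (Fin n)) (s : Finset (Fin n)) : Prop :=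
  (∀ a ∈ s, ∀ b ∈ s, ∀ j : Fin n, a ≤ j → j ≤ b → j ∈ s) ∧
  (∀ a ∈ s, ∀ b ∈ s, ∀ j : Fin n, π a ≤ π j → π j ≤ π b → j ∈ s)

/-- `π` is simple: its only intervals are singletons (or empty) and the whole domain. -/
def IsSimple {n : ℕ} (π : Equiv.Perm (Fin n)) : Prop :=
  ∀ s : Finset (Fin n), IsPermInterval π s → s.card ≤ 1 ∨ s = Finset.univ

/-- The reverse complement of a permutation. -/
def revComp {n : ℕ} (π : Equiv.Perm (Fin n)) : Equiv.Perm (Fin n) :=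
  (Fin.revPerm.trans π).trans Fin.revPerm

/-- The skew sum `σ ⊖ τ`. -/
def skewSum {m k : ℕ} (σ : Equiv.Perm (Fin m)) (τ : Equiv.Perm (Fin k)) :
    Equiv.Perm (Fin (m + k)) :=
  finSumFinEquiv.symm.trans ((Equiv.sumCongr σ τ).trans
    ((Equiv.sumComm (Fin m) (Fin k)).trans (finSumFinEquiv.trans (finCongr (Nat.add_comm k m)))))

/-- The direct sum `α ⊕ β`. -/
def directSum {m k : ℕ} (α : Equiv.Perm (Fin m)) (β : Equiv.Perm (Fin k)) :
    Equiv.Perm (Fin (m + k)) :=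
  finSumFinEquiv.symm.trans ((Equiv.sumCongr α β).trans finSumFinEquiv)

/-- The permutation 312 (0-indexed values). -/
noncomputable def p312 : Equiv.Perm (Fin 3) := Equiv.ofBijective ![2,0,1] (by decide)

/-- The permutation 231 (0-indexed values). -/
noncomputable def p231 : Equiv.Perm (Fin 3) := Equiv.ofBijective ![1,2,0] (by decide)

/-- The number of simple permutations of length `n` in the class 𝒜. -/
noncomputable def simpleCount (n : ℕ) : ℕ :=
  Nat.card {π : Equiv.Perm (Fin n) // IsSimple π ∧ InA π}


/-- `SimpleOn π T`: every subset of `T` with at least two points which misses a point of `T` is cut,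
in position or in value, by a point of `T` outside of it. -/
def SimpleOn {n : ℕ} (π : Equiv.Perm (Fin n)) (T : Fin n → Prop) : Prop :=
  ∀ S : Fin n → Prop, (∀ x, S x → T x) → (∃ a b, S a ∧ S b ∧ a ≠ b) → (∃ c, T c ∧ ¬ S c) →
    ∃ x y z, S x ∧ S y ∧ T z ∧ ¬ S z ∧ ((x < z ∧ z < y) ∨ (π x < π z ∧ π z < π y))

/-- `At π i v`: the permutation `π` has the value `v` at position `i` (0-indexed). -/
def At {n : ℕ} (π : Equiv.Perm (Fin n)) (i v : ℕ) : Prop :=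
  ∃ h : i < n, (π ⟨i, h⟩ : ℕ) = v

theorem At.mk {n : ℕ} {π : Equiv.Perm (Fin n)} {i v : ℕ} (x : Fin n) (hi : (x : ℕ) = i)
    (hv : (π x : ℕ) = v) : At π i v := by
  subst hi; exact ⟨x.2, hv⟩

theorem At.obtain {n : ℕ} {π : Equiv.Perm (Fin n)} {i v : ℕ} (h : At π i v) :
    ∃ x : Fin n, (x : ℕ) = i ∧ (π x : ℕ) = v :=
  ⟨⟨i, h.1⟩, rfl, h.2⟩

theorem At.val_unique {n : ℕ} {π : Equiv.Perm (Fin n)} {i v w : ℕ} (h : At π i v)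
    (h' : At π i w) : v = w := by
  obtain ⟨_, h⟩ := h
  obtain ⟨_, h'⟩ := h'
  exact h.symm.trans h'

theorem At.pos_unique {n : ℕ} {π : Equiv.Perm (Fin n)} {i j v : ℕ} (h : At π i v)
    (h' : At π j v) : i = j := by
  obtain ⟨_, h⟩ := h
  obtain ⟨_, h'⟩ := h'
  exact congrArg Fin.val (π.injective (Fin.ext (h.trans h'.symm)))

theorem exists_at {n : ℕ} (π : Equiv.Perm (Fin n)) {v : ℕ} (hv : v < n) : ∃ i, At π i v :=
  ⟨π.symm ⟨v, hv⟩, At.mk (π.symm ⟨v, hv⟩) rfl (by simp)⟩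

theorem isSimple_iff_simpleOn {n : ℕ} (π : Equiv.Perm (Fin n)) :
    IsSimple π ↔ SimpleOn π (fun _ => True) := by
  classical
  constructor
  · rintro h S - ⟨a, b, ha, hb, hab⟩ ⟨c, -, hc⟩
    by_contra hno
    push Not at hno
    have key := h (Finset.univ.filter S) ⟨?_, ?_⟩
    · rcases key with key | key
      · exact hab (Finset.card_le_one.1 key a (by simpa using ha) b (by simpa using hb))
      · have : c ∈ Finset.univ.filter S := by rw [key]; exact Finset.mem_univ c
        exact hc (by simpa using this)
    · intro x hx y hy z h1 h2
      simp only [Finset.mem_filter, Finset.mem_univ, true_and] at *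
      by_contra hz
      have := (hno x y z hx hy trivial hz).1 (lt_of_le_of_ne h1 (by rintro rfl; exact hz hx))
      exact absurd (lt_of_le_of_ne h2 (by rintro rfl; exact hz hy)) (not_lt.2 this)
    · intro x hx y hy z h1 h2
      simp only [Finset.mem_filter, Finset.mem_univ, true_and] at *
      by_contra hz
      have := (hno x y z hx hy trivial hz).2
        (lt_of_le_of_ne h1 (fun h => hz (π.injective h ▸ hx)))
      exact absurd (lt_of_le_of_ne h2 (fun h => hz (π.injective h ▸ hy))) (not_lt.2 this)
  · intro h s hs
    by_contra hno
    push Not at hno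
    obtain ⟨h1, h2⟩ := hno
    obtain ⟨a, ha, b, hb, hab⟩ := Finset.one_lt_card.1 h1
    have : ∃ c, c ∉ s := by
      by_contra hc
      push Not at hc
      exact h2 (Finset.eq_univ_iff_forall.2 hc)
    obtain ⟨c, hc⟩ := this
    obtain ⟨x, y, z, hx, hy, -, hz, h | h⟩ :=
      h (· ∈ s) (fun _ _ => trivial) ⟨a, b, ha, hb, hab⟩ ⟨c, trivial, hc⟩
    · exact hz (hs.1 x hx y hy z h.1.le h.2.le)
    · exact hz (hs.2 x hx y hy z h.1.le h.2.le)

/-- Simplicity of a pattern of `π` can be tested on the points of an occurrence. -/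
theorem isSimple_iff_simpleOn_of_occurrence {m n : ℕ} {σ : Equiv.Perm (Fin m)}
    {π : Equiv.Perm (Fin n)} {e : Fin m → Fin n} {T : Fin n → Prop} (he : StrictMono e)
    (hσ : ∀ i j, σ i < σ j ↔ π (e i) < π (e j)) (hT : ∀ x, T x ↔ ∃ i, e i = x) :
    IsSimple σ ↔ SimpleOn π T := by
  rw [isSimple_iff_simpleOn]
  constructor
  · rintro h S hS ⟨a, b, ha, hb, hab⟩ ⟨c, hc, hc'⟩
    obtain ⟨a, rfl⟩ := (hT _).1 (hS _ ha)
    obtain ⟨b, rfl⟩ := (hT _).1 (hS _ hb)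
    obtain ⟨c, rfl⟩ := (hT _).1 hc
    obtain ⟨x, y, z, hx, hy, -, hz, h⟩ := h (fun i => S (e i)) (fun _ _ => trivial)
      ⟨a, b, ha, hb, fun h => hab (h ▸ rfl)⟩ ⟨c, trivial, hc'⟩
    refine ⟨e x, e y, e z, hx, hy, (hT _).2 ⟨z, rfl⟩, hz, ?_⟩
    simpa only [he.lt_iff_lt, ← hσ] using h
  · rintro h S - ⟨a, b, ha, hb, hab⟩ ⟨c, -, hc⟩
    have hmem : ∀ i, (∃ j, S j ∧ e j = e i) ↔ S i := fun i =>
      ⟨fun ⟨j, hj, hji⟩ => he.injective hji ▸ hj, fun hi => ⟨i, hi, rfl⟩⟩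
    obtain ⟨x, y, z, ⟨x, hx, rfl⟩, ⟨y, hy, rfl⟩, hz, hz', h⟩ := h (fun u => ∃ j, S j ∧ e j = u)
      (fun u ⟨j, _, hju⟩ => (hT u).2 ⟨j, hju⟩)
      ⟨e a, e b, (hmem a).2 ha, (hmem b).2 hb, fun h => hab (he.injective h)⟩
      ⟨e c, (hT _).2 ⟨c, rfl⟩, fun h => hc ((hmem c).1 h)⟩
    obtain ⟨z, rfl⟩ := (hT _).1 hz
    refine ⟨x, y, z, hx, hy, trivial, fun h => hz' ((hmem z).2 h), ?_⟩
    simpa only [he.lt_iff_lt, ← hσ] using h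

theorem IsSimple.symm {n : ℕ} {π : Equiv.Perm (Fin n)} (h : IsSimple π) : IsSimple π.symm := by
  rw [isSimple_iff_simpleOn] at *
  rintro S - ⟨a, b, ha, hb, hab⟩ ⟨c, -, hc⟩
  obtain ⟨x, y, z, hx, hy, -, hz, h⟩ := h (fun i => S (π i)) (fun _ _ => trivial)
    ⟨π.symm a, π.symm b, by simpa, by simpa, by simpa using hab⟩ ⟨π.symm c, trivial, by simpa⟩
  exact ⟨π x, π y, π z, hx, hy, trivial, hz, by simpa using h.symm⟩

theorem Contains.symm {k n : ℕ} {τ : Equiv.Perm (Fin k)} {π : Equiv.Perm (Fin n)}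
    (h : Contains τ π) : Contains τ.symm π.symm := by
  obtain ⟨f, hf, h⟩ := h
  refine ⟨fun i => π (f (τ.symm i)), fun i j hij => ?_, fun i j => ?_⟩
  · rw [← h]; simpa using hij
  · simp [hf.lt_iff_lt]

theorem symm_eq_self_of_apply_apply {k : ℕ} {τ : Equiv.Perm (Fin k)} (h : ∀ i, τ (τ i) = i) :
    τ.symm = τ :=
  Equiv.ext fun i => by rw [Equiv.symm_apply_eq, h]

theorem InA.symm {n : ℕ} {π : Equiv.Perm (Fin n)} (h : InA π) : InA π.symm := by
  obtain ⟨h1, h2, h3, h4⟩ := h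
  refine ⟨fun h => h1 ?_, fun h => h2 ?_, fun h => h3 ?_, fun h => h4 ?_⟩
  · simpa [symm_eq_self_of_apply_apply (τ := p4231) (by decide)] using h.symm
  · simpa [symm_eq_self_of_apply_apply (τ := p35142) (by decide)] using h.symm
  · simpa [symm_eq_self_of_apply_apply (τ := p42513) (by decide)] using h.symm
  · simpa [symm_eq_self_of_apply_apply (τ := p351624) (by decide)] using h.symm

/-- The properties of the four forbidden patterns on which the insertions below rely. -/
structure Robust {k : ℕ} (τ : Equiv.Perm (Fin k)) : Prop where
  one_lt_first : ∀ i : Fin k, (i : ℕ) = 0 → 1 < (τ i : ℕ)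
  not_adjacent : ∀ i j : Fin k, (τ i : ℕ) = 0 → (τ j : ℕ) = 1 →
    (i : ℕ) + 1 ≠ j ∧ (j : ℕ) + 1 ≠ i

theorem inA_of_robust {m n : ℕ} {σ : Equiv.Perm (Fin m)} {π : Equiv.Perm (Fin n)}
    (h : ∀ (k : ℕ) (τ : Equiv.Perm (Fin k)), Robust τ → Contains τ π → Contains τ σ)
    (hσ : InA σ) : InA π := by
  obtain ⟨h1, h2, h3, h4⟩ := hσ
  exact ⟨fun hc => h1 (h _ _ ⟨by decide, by decide⟩ hc),
    fun hc => h2 (h _ _ ⟨by decide, by decide⟩ hc),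
    fun hc => h3 (h _ _ ⟨by decide, by decide⟩ hc),
    fun hc => h4 (h _ _ ⟨by decide, by decide⟩ hc)⟩

theorem InA.of_occurrence {m n : ℕ} {σ : Equiv.Perm (Fin m)} {π : Equiv.Perm (Fin n)}
    {e : Fin m → Fin n} (he : StrictMono e) (hσ : ∀ i j, σ i < σ j ↔ π (e i) < π (e j))
    (h : InA π) : InA σ :=
  inA_of_robust (fun _ _ _ ⟨f, hf, hτ⟩ =>
    ⟨e ∘ f, he.comp hf, fun i j => (hτ i j).trans (hσ _ _)⟩) h

theorem contains_of_occurrence {k m n : ℕ} {τ : Equiv.Perm (Fin k)} {σ : Equiv.Perm (Fin m)}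
    {π : Equiv.Perm (Fin n)} {e : Fin m → Fin n} {T : Fin n → Prop} (he : StrictMono e)
    (hσ : ∀ i j, σ i < σ j ↔ π (e i) < π (e j)) (hT : ∀ x, T x ↔ ∃ i, e i = x)
    {f : Fin k → Fin n} (hf : StrictMono f) (hτ : ∀ i j, τ i < τ j ↔ π (f i) < π (f j))
    (hfT : ∀ i, T (f i)) : Contains τ σ := by
  choose g hg using fun i => (hT _).1 (hfT i)
  refine ⟨g, fun i j hij => ?_, fun i j => ?_⟩
  · rw [← he.lt_iff_lt, hg, hg]; exact hf hij
  · rw [hσ, hg, hg, hτ]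

section Forbidden

variable {n : ℕ} {π : Equiv.Perm (Fin n)} {a b c d e f : Fin n}

theorem InA.not_4231 (h : InA π) (h1 : a < b) (h2 : b < c) (h3 : c < d) (v1 : π d < π b)
    (v2 : π b < π c) (v3 : π c < π a) : False := by
  refine h.1 ⟨![a, b, c, d], ?_, ?_⟩
  · rw [Fin.strictMono_iff_lt_succ]
    intro i; fin_cases i <;> simp [*]
  · intro i j; fin_cases i <;> fin_cases j <;> simp [p4231] <;> grind

theorem InA.not_35142 (h : InA π) (h1 : a < b) (h2 : b < c) (h3 : c < d) (h4 : d < e)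
    (v1 : π c < π e) (v2 : π e < π a) (v3 : π a < π d) (v4 : π d < π b) : False := by
  refine h.2.1 ⟨![a, b, c, d, e], ?_, ?_⟩
  · rw [Fin.strictMono_iff_lt_succ]
    intro i; fin_cases i <;> simp [*]
  · intro i j; fin_cases i <;> fin_cases j <;> simp [p35142] <;> grind

theorem InA.not_42513 (h : InA π) (h1 : a < b) (h2 : b < c) (h3 : c < d) (h4 : d < e)
    (v1 : π d < π b) (v2 : π b < π e) (v3 : π e < π a) (v4 : π a < π c) : False := by
  refine h.2.2.1 ⟨![a, b, c, d, e], ?_, ?_⟩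
  · rw [Fin.strictMono_iff_lt_succ]
    intro i; fin_cases i <;> simp [*]
  · intro i j; fin_cases i <;> fin_cases j <;> simp [p42513] <;> grind

theorem InA.not_351624 (h : InA π) (h1 : a < b) (h2 : b < c) (h3 : c < d) (h4 : d < e)
    (h5 : e < f) (v1 : π c < π e) (v2 : π e < π a) (v3 : π a < π f) (v4 : π f < π b)
    (v5 : π b < π d) : False := by
  refine h.2.2.2 ⟨![a, b, c, d, e, f], ?_, ?_⟩
  · rw [Fin.strictMono_iff_lt_succ]
    intro i; fin_cases i <;> simp [*]
  · intro i j; fin_cases i <;> fin_cases j <;> simp [p351624] <;> grind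

end Forbidden

theorem IsSimple.exists_cut {n : ℕ} {π : Equiv.Perm (Fin n)} (h : IsSimple π) (S : Fin n → Prop)
    {a b c : Fin n} (ha : S a) (hb : S b) (hab : a ≠ b) (hc : ¬ S c) :
    ∃ x y z, S x ∧ S y ∧ ¬ S z ∧ ((x < z ∧ z < y) ∨ (π x < π z ∧ π z < π y)) := by
  obtain ⟨x, y, z, hx, hy, -, hz, h⟩ := (isSimple_iff_simpleOn π).1 h S (fun _ _ => trivial)
    ⟨a, b, ha, hb, hab⟩ ⟨c, trivial, hc⟩
  exact ⟨x, y, z, hx, hy, hz, h⟩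

/-- In a simple permutation of the class, a block of consecutive positions cannot end in its
minimum `π i` when it is followed by a larger entry and then by a smaller one. -/
theorem IsSimple.false_of_block {n : ℕ} {π : Equiv.Perm (Fin n)} (hs : IsSimple π) (hA : InA π)
    {p i x k : Fin n} (hpi : p < i) (hix : i < x) (hxk : x < k) (hk : π k < π i)
    (hx : π i < π x) (hblock : ∀ y, p ≤ y → y < i → π i < π y) (hleft : ∀ z, z < p → π z < π i) :
    False := by
  obtain ⟨a, b, z, ha, hb, hz, h | h⟩ := hs.exists_cut (fun y => p ≤ y ∧ y ≤ i)
    (a := p) (b := i) (c := k) ⟨le_rfl, hpi.le⟩ ⟨hpi.le, le_rfl⟩ hpi.ne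
    (fun h => absurd (hix.trans hxk) (not_lt.2 h.2))
  · exact hz ⟨ha.1.trans h.1.le, h.2.le.trans hb.2⟩
  · have hia : π i ≤ π a := by
      rcases ha.2.lt_or_eq with h' | h'
      · exact (hblock a ha.1 h').le
      · rw [h']
    have hbi : b < i := by
      rcases hb.2.lt_or_eq with h' | h'
      · exact h'
      · subst h'; exact absurd (h.1.trans h.2) (not_lt.2 hia)
    have hiz : i < z := by
      by_contra hzi
      rcases lt_or_ge z p with h' | h'
      · exact absurd (hleft z h') (not_lt.2 (hia.trans h.1.le))
      · exact hz ⟨h', not_lt.1 hzi⟩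
    have hbx : π b < π x := by
      rcases lt_trichotomy (π b) (π x) with h' | h' | h'
      · exact h'
      · exact absurd (π.injective h') (hbi.trans hix).ne
      · exact (hA.not_4231 hbi hix hxk hk hx h').elim
    rcases lt_trichotomy z k with h' | rfl | h'
    · exact hA.not_4231 hbi hiz h' hk (hia.trans_lt h.1) h.2
    · exact absurd (hia.trans_lt h.1) (not_lt.2 hk.le)
    · exact hA.not_42513 hbi hix hxk h' hk (hia.trans_lt h.1) h.2 hbx

/-- If no point lies below the first entry and to the right of the minimum, then the first entry
is the second smallest. -/
theorem IsSimple.first_le_one_of_forall {n : ℕ} {π : Equiv.Perm (Fin n)} (hs : IsSimple π)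
    (hA : InA π) {o k : Fin n} (ho : (o : ℕ) = 0) (hk : (π k : ℕ) = 0)
    (hR : ∀ r, k < r → π o < π r) : (π o : ℕ) ≤ 1 := by
  by_contra hgt
  obtain ⟨d, hd⟩ := π.surjective ⟨π o - 1, by omega⟩
  obtain ⟨d', hd'⟩ := π.surjective ⟨π o - 2, by omega⟩
  have hd : (π d : ℕ) = π o - 1 := by rw [hd]
  have hd' : (π d' : ℕ) = π o - 2 := by rw [hd']
  have dec : ∀ x y, x < y → π x < π y → π y < π o → False := by
    intro x y hxy hv hvo
    have hyk : y < k := by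
      rcases lt_trichotomy y k with h | rfl | h
      · exact h
      · omega
      · exact absurd (hR y h) (not_lt.2 hvo.le)
    have hox : o < x := by
      rcases Nat.eq_zero_or_pos (x : ℕ) with h | h
      · have : x = o := Fin.ext (h.trans ho.symm)
        subst this; omega
      · omega
    refine hA.not_4231 hox hxy hyk ?_ hv hvo
    rcases Nat.eq_zero_or_pos (π x : ℕ) with h | h
    · have : x = k := π.injective (Fin.ext (h.trans hk.symm))
      subst this; omega
    · omega
  have hdd' : d < d' := by
    rcases lt_trichotomy d d' with h | rfl | h
    · exact h
    · omega
    · exact (dec d' d h (by omega) (by omega)).elim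
  have hod : o < d := by
    rcases Nat.eq_zero_or_pos (d : ℕ) with h | h
    · have : d = o := Fin.ext (h.trans ho.symm)
      subst this; omega
    · omega
  have hd'k : d' ≤ k := by
    by_contra h
    have := hR d' (not_le.1 h)
    omega
  have hlarge : ∀ y, y < d → π d < π y := by
    intro y hy
    by_contra h
    have : π y ≠ π d := fun h => hy.ne (π.injective h)
    exact dec y d hy (by omega) (by omega)
  obtain ⟨x, y, z, hx, hy, hz, h⟩ := hs.exists_cut (fun y => y = d ∨ y = d') (a := d) (b := d')
    (c := o) (Or.inl rfl) (Or.inr rfl) hdd'.ne (by omega)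
  have hdz : d < z ∧ z < d' := by
    rcases hx with rfl | rfl <;> rcases hy with rfl | rfl <;> omega
  refine hs.false_of_block hA hod hdz.1 (hdz.2.trans_le hd'k) ?_ ?_ (fun y _ => hlarge y)
    (fun z hz => by omega)
  · have : π k ≠ π d := fun h => absurd (π.injective h) (by omega)
    omega
  · by_contra h
    have h1 : π z ≠ π d := fun h => absurd (π.injective h) (by omega)
    have h2 : π z ≠ π d' := fun h => absurd (π.injective h) (by omega)
    exact dec z d' hdz.2 (by omega) (by omega)

/-- A simple permutation of the class has `1` as its first value or its minimum in second place. -/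
theorem IsSimple.first_or_second {n : ℕ} {π : Equiv.Perm (Fin n)} (hs : IsSimple π)
    (hA : InA π) {o k : Fin n} (ho : (o : ℕ) = 0) (hk : (π k : ℕ) = 0) :
    (π o : ℕ) ≤ 1 ∨ (k : ℕ) ≤ 1 := by
  by_cases hR : ∀ r, k < r → π o < π r
  · exact Or.inl (hs.first_le_one_of_forall hA ho hk hR)
  by_cases hU : ∀ u, π o < π u → k < u
  · right
    have := hs.symm.first_le_one_of_forall hA.symm (o := π k) (k := π o) hk (by simpa using ho)
      (fun r hr => by simpa using hU (π.symm r) (by simpa using hr))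
    simpa using this
  exfalso
  push Not at hR hU
  have hmin : ∀ x, x ≠ k → π k < π x := fun x hx => by
    have : (π x : ℕ) ≠ 0 := fun h => hx (π.injective (Fin.ext (h.trans hk.symm)))
    omega
  have hfst : ∀ x, x ≠ o → o < x := fun x hx => by
    have : (x : ℕ) ≠ 0 := fun h => hx (Fin.ext (h.trans ho.symm))
    omega
  have inj : ∀ x y, π x = π y → x = y := fun x y h => π.injective h
  obtain ⟨u₀, hu₀, hu₀k⟩ := hU
  obtain ⟨r₀, hr₀, hr₀o⟩ := hR
  have hok : o < k := hfst k (by rintro rfl; have := hmin r₀ (by omega); grind)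
  have hko : π k < π o := hmin o hok.ne
  have dec : ∀ x y, o < x → x < y → y < k → π x < π y → π y < π o → False :=
    fun x y h1 h2 h3 h4 h5 => hA.not_4231 h1 h2 h3 (hmin x (by omega)) h4 h5
  have key1 : ∃ q r, k < q ∧ π o < π q ∧ q < r ∧ π r < π o := by
    classical
    obtain ⟨r, hr, hmax⟩ := Finset.exists_max_image
      (Finset.univ.filter (fun r => k < r ∧ π r < π o)) π ⟨r₀, by grind⟩
    simp only [Finset.mem_filter, Finset.mem_univ, true_and] at hr hmax
    obtain ⟨x, y, z, hx, hy, hz, h⟩ := hs.exists_cut (fun x => π x ≤ π r) (a := k) (b := r)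
      (c := o) (hmin r (by omega)).le le_rfl (by omega) (by omega)
    have hzo : o ≠ z := by
      rintro rfl
      have := hfst x
      grind
    rcases lt_trichotomy z k with hzk | rfl | hzk
    · rcases lt_or_ge (π o) (π z) with h' | h'
      · exact (hA.not_42513 (a := o) (b := x) (c := z) (d := k) (e := r) (by grind) (by grind)
          hzk hr.1 (by grind) (by grind) hr.2 h').elim
      · exact (dec x z (by grind) (by grind) (by grind) (by grind) (by grind)).elim
    · grind
    · exact ⟨z, y, hzk, by grind, by grind, by grind⟩
  have key2 : ∃ q u, k < q ∧ π o < π q ∧ π q < π u ∧ u < k := by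
    classical
    obtain ⟨u, hu, hmax⟩ := Finset.exists_max_image
      (Finset.univ.filter (fun u => u < k ∧ π o < π u)) id ⟨u₀, by grind⟩
    simp only [Finset.mem_filter, Finset.mem_univ, true_and, id] at hu hmax
    obtain ⟨x, y, z, hx, hy, hz, h⟩ := hs.exists_cut (fun x => x ≤ u) (a := o) (b := u)
      (c := k) (by grind) le_rfl (by grind) (by grind)
    have hzk : z ≠ k := by
      rintro rfl
      have := hmin x
      grind
    rcases lt_trichotomy (π z) (π o) with h' | h' | h'
    · rcases lt_or_ge z k with h'' | h''
      · exact (dec x z (by grind) (by grind) (by grind) (by grind) (by grind)).elim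
      · exact (hA.not_42513 (a := o) (b := x) (c := u) (d := k) (e := z) (by grind) (by grind)
          hu.1 (by grind) (by grind) (by grind) (by grind) hu.2).elim
    · grind
    · exact ⟨z, y, by grind, h', by grind, by grind⟩
  obtain ⟨q, r, hq1, hq2, hqr, hr⟩ := key1
  obtain ⟨q', u, hq'1, hq'2, hq'u, hu⟩ := key2
  have hou : o < u := hfst u (by grind)
  have hkr : π k < π r := hmin r (by grind)
  have h1 : π u < π q := by
    by_contra h
    exact hA.not_35142 hou hu hq1 hqr hkr hr hq2 (by grind)
  have h2 : r < q' := by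
    by_contra h
    exact hA.not_35142 hou hu hq'1 (by grind) hkr hr hq'2 hq'u
  exact hA.not_351624 hou hu hq1 hqr h2 hkr hr hq'2 hq'u h1

set_option maxHeartbeats 1000000 in
/-- The places of the values `2` and `3` in a simple permutation of the class which starts
with `1` and does not have its minimum in third place. -/
theorem IsSimple.shape {n : ℕ} {π : Equiv.Perm (Fin n)} (hs : IsSimple π) (hA : InA π)
    {o k t w : Fin n} (ho : (o : ℕ) = 0) (hπo : (π o : ℕ) = 1) (hπk : (π k : ℕ) = 0)
    (hπt : (π t : ℕ) = 2) (hπw : (π w : ℕ) = 3) (hk : 2 < (k : ℕ)) :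
    (t : ℕ) + 1 = k ∨ ((k : ℕ) + 1 = t ∧ ((w : ℕ) = 1 ∨ (w : ℕ) + 1 = k)) := by
  have inj : ∀ x y, (π x : ℕ) = π y → x = y := fun x y h => π.injective (Fin.ext h)
  have hval : ∀ y, y ≠ o → y ≠ k → y ≠ t → 2 < (π y : ℕ) := by grind
  have hfst : ∀ x, x ≠ o → 0 < (x : ℕ) := fun x hx => by
    have : (x : ℕ) ≠ 0 := fun h => hx (Fin.ext (h.trans ho.symm))
    omega
  have h1n : 1 < n := by omega
  have h2n : 2 < n := by omega
  rcases lt_trichotomy t k with htk | rfl | htk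
  · left
    by_contra hne
    have ht1 : 1 < (t : ℕ) := by
      by_contra ht
      obtain ⟨x, y, z, hx, hy, hz, h⟩ := hs.exists_cut (fun x => x = o ∨ x = t) (a := o) (b := t)
        (c := k) (by simp) (by simp) (by grind) (by grind)
      grind
    refine hs.false_of_block hA (p := ⟨1, h1n⟩) (i := t) (x := ⟨t + 1, by omega⟩) (k := k)
      ht1 (Fin.lt_def.2 (by simp)) (Fin.lt_def.2 (by simp; omega)) (by omega) ?_ ?_ ?_
    · have := hval ⟨t + 1, by omega⟩ (by grind) (by grind) (by grind)
      omega
    · intro y hy hyt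
      have := hval y (by grind) (by grind) (by grind)
      omega
    · intro z hz
      have : z = o := Fin.ext (by grind)
      subst this; omega
  · omega
  · right
    have low : ∀ u u' z y, o < u → o < u' → u < k → u' < k → k < z → z < y → π k < π y →
        π y < π u → π u < π z → π z < π u' → False := by
      intro u u' z y h1 h2 h3 h4 h5 h6 h7 h8 h9 h10
      rcases lt_trichotomy u u' with h | rfl | h
      · exact hA.not_35142 h h4 h5 h6 h7 h8 h9 h10
      · grind
      · exact hA.not_4231 h (h3.trans h5) h6 h8 h9 h10
    obtain ⟨u, u', c, hu, hu', hc, h⟩ := hs.exists_cut (fun x => o < x ∧ x < k)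
      (a := ⟨1, h1n⟩) (b := ⟨2, h2n⟩) (c := o) (by grind) (by grind) (by grind) (by grind)
    have hcu : π u < π c ∧ π c < π u' := by grind
    have hu2 : 2 < (π u : ℕ) := hval u (by grind) (by grind) (by grind)
    have hkc : k < c := by
      have := hfst c (by grind)
      grind
    have hJ : ∀ z y, k < z → z < y → (∀ w, o < w → w < k → π y < π w) →
        ∀ w, o < w → w < k → π z < π w := by
      intro z y hz hzy hy w hw hwk
      by_contra hzw
      have hzw : π w < π z := by grind
      have hky : π k < π y := by grind
      rcases lt_or_ge (π z) (π u') with h' | h'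
      · exact low w u' z y hw hu'.1 hwk hu'.2 hz hzy hky (hy w hw hwk) hzw h'
      · have h' : π u' < π z := by grind
        have hyc : y < c := by
          by_contra hcy
          rcases lt_trichotomy c y with h'' | rfl | h''
          · exact low u u' c y hu.1 hu'.1 hu.2 hu'.2 hkc h'' hky (hy u hu.1 hu.2) hcu.1 hcu.2
          · have := hy u hu.1 hu.2
            grind
          · exact hcy h''
        have hyu : π y < π u := hy u hu.1 hu.2
        rcases lt_trichotomy u u' with h'' | rfl | h''
        · exact hA.not_351624 h'' hu'.2 hz hzy hyc hky hyu hcu.1 hcu.2 h'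
        · grind
        · exact hA.not_42513 h'' (hu.2.trans hz) hzy hyc hyu hcu.1 hcu.2 h'
    have htU : ∀ w, o < w → w < k → π t < π w := fun w hw hwk => by
      have := hval w (by grind) (by grind) (by grind)
      omega
    have hone : ∀ x, k < x → (∀ w, o < w → w < k → π x < π w) → x = t := by
      intro y hky hy
      by_contra hne
      obtain ⟨x, y, z, hx, hy, hz, h⟩ := hs.exists_cut
        (fun x => k < x ∧ ∀ w, o < w → w < k → π x < π w)
        (a := t) (b := y) (c := o) ⟨htk, htU⟩ ⟨hky, hy⟩ (Ne.symm hne) (by grind)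
      rcases h with h | h
      · exact hz ⟨hx.1.trans h.1, hJ z y (hx.1.trans h.1) h.2 hy.2⟩
      · have hzU : ∀ w, o < w → w < k → π z < π w := fun w hw hwk => h.2.trans (hy.2 w hw hwk)
        have hx2 : 2 ≤ (π x : ℕ) := by
          rcases eq_or_ne x t with rfl | hxt
          · omega
          · exact (hval x (by omega) (by omega) hxt).le
        have hzo : z ≠ o := by rintro rfl; omega
        have hzk : z ≠ k := by rintro rfl; omega
        have hz' : ¬ k < z := fun h => hz ⟨h, hzU⟩
        have := hfst z hzo
        exact lt_irrefl _ (hzU z (by omega) (by omega))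
    have htk1 : (k : ℕ) + 1 = t := by
      by_contra hne
      have := hone ⟨k + 1, by omega⟩ (Fin.lt_def.2 (by simp))
        (hJ _ t (Fin.lt_def.2 (by simp)) (Fin.lt_def.2 (by simp; omega)) htU)
      grind
    refine ⟨htk1, ?_⟩
    have hwk : w < k := by
      by_contra hwk
      have := hone w (by grind) (fun x hx hxk => by
        have := hval x (by grind) (by grind) (by grind)
        grind)
      grind
    have hw0 := hfst w (by grind)
    by_contra hne
    refine hs.false_of_block hA (p := ⟨1, h1n⟩) (i := w) (x := ⟨w + 1, by omega⟩) (k := k)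
      (Fin.lt_def.2 (by simp; omega)) (Fin.lt_def.2 (by simp)) (Fin.lt_def.2 (by simp; omega))
      (by omega) ?_ ?_ ?_
    · have := hval ⟨w + 1, by omega⟩ (by grind) (by grind) (by grind)
      have := inj w ⟨w + 1, by omega⟩
      grind
    · intro y hy hyt
      have := hval y (by grind) (by grind) (by grind)
      grind
    · intro z hz
      have : z = o := Fin.ext (by grind)
      subst this; omega

/-- The points of `S` form an interval relative to the points of `T`. -/
def ConvexIn {n : ℕ} (π : Equiv.Perm (Fin n)) (T S : Fin n → Prop) : Prop :=
  ∀ x y z, S x → S y → T z → ((x < z ∧ z < y) ∨ (π x < π z ∧ π z < π y)) → S z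

theorem simpleOn_iff {n : ℕ} {π : Equiv.Perm (Fin n)} {T : Fin n → Prop} :
    SimpleOn π T ↔ ∀ S : Fin n → Prop, (∀ x, S x → T x) → ConvexIn π T S →
      ∀ a b c, S a → S b → a ≠ b → T c → S c := by
  constructor
  · intro h S hS hconv a b c ha hb hab hc
    by_contra hSc
    obtain ⟨x, y, z, hx, hy, hz, hz', h⟩ := h S hS ⟨a, b, ha, hb, hab⟩ ⟨c, hc, hSc⟩
    exact hz' (hconv x y z hx hy hz h)
  · rintro h S hS ⟨a, b, ha, hb, hab⟩ ⟨c, hc, hSc⟩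
    by_contra hno
    push Not at hno
    refine hSc (h S hS ?_ a b c ha hb hab hc)
    intro x y z hx hy hz hcut
    by_contra hSz
    have := hno x y z hx hy hz hSz
    grind

theorem SimpleOn.exists_cut_pair {n : ℕ} {π : Equiv.Perm (Fin n)} {T : Fin n → Prop}
    (h : SimpleOn π T) {a b c : Fin n} (ha : T a) (hb : T b) (hc : T c) (hab : a ≠ b)
    (hac : a ≠ c) (hbc : b ≠ c) :
    ∃ z, T z ∧ ((a < z ∧ z < b) ∨ (b < z ∧ z < a) ∨ (π a < π z ∧ π z < π b) ∨
      (π b < π z ∧ π z < π a)) := by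
  obtain ⟨x, y, z, hx, hy, hz, -, h⟩ := h (fun x => x = a ∨ x = b) (by grind)
    ⟨a, b, by grind, by grind, hab⟩ ⟨c, hc, by grind⟩
  refine ⟨z, hz, ?_⟩
  rcases hx with rfl | rfl <;> rcases hy with rfl | rfl <;> grind

section Deletion

variable {n : ℕ} {π : Equiv.Perm (Fin n)} {o e k t : Fin n}

/-- Inserting a new first entry with value `1` in front of a simple permutation which has its
minimum in second place. -/
theorem simpleOn_of_delete_first (ho : (o : ℕ) = 0) (he : (e : ℕ) = 1) (hk : (k : ℕ) = 2)
    (hπo : (π o : ℕ) = 1) (hπk : (π k : ℕ) = 0) (hπt : (π t : ℕ) = 2) (hn : 3 < n)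
    (h : SimpleOn π (fun x => x ≠ o)) :
    SimpleOn π (fun _ => True) ∧ (t : ℕ) ≠ 3 := by
  have inj : ∀ x y, (π x : ℕ) = π y → x = y := fun x y h => π.injective (Fin.ext h)
  have pos : ∀ x y : Fin n, (x : ℕ) = y → x = y := fun x y h => Fin.ext h
  have h3 : ∃ d : Fin n, (d : ℕ) = 3 := ⟨⟨3, hn⟩, rfl⟩
  obtain ⟨d, hd⟩ := h3
  have hte : t ≠ e := by
    rintro rfl
    obtain ⟨z, hz, hcut⟩ := h.exists_cut_pair (a := t) (b := k) (c := d) (by grind) (by grind)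
      (by grind) (by grind) (by grind) (by grind)
    have := inj z o
    have := inj z k
    grind
  have htd : t ≠ d := by
    rintro rfl
    obtain ⟨z, hz, hcut⟩ := h.exists_cut_pair (a := t) (b := k) (c := e) (by grind) (by grind)
      (by grind) (by grind) (by grind) (by grind)
    have := inj z o
    have := inj z k
    grind
  refine ⟨?_, by grind⟩
  rw [simpleOn_iff] at h ⊢
  intro S _ hconv a b c ha hb hab _
  by_cases hS : ∃ x y, S x ∧ S y ∧ x ≠ o ∧ y ≠ o ∧ x ≠ y
  · obtain ⟨x, y, hx, hy, hxo, hyo, hxy⟩ := hS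
    have hall : ∀ c, c ≠ o → S c := fun c hc =>
      (h (fun x => S x ∧ x ≠ o) (by grind) (fun x y z hx hy hz hcut =>
        ⟨hconv x y z hx.1 hy.1 trivial hcut, hz⟩) x y c ⟨hx, hxo⟩ ⟨hy, hyo⟩ hxy hc).1
    rcases eq_or_ne c o with rfl | hc
    · exact hconv k t c (hall k (by grind)) (hall t (by grind)) trivial (by grind)
    · exact hall c hc
  · exfalso
    have hSo : S o := by grind
    obtain ⟨b, hb, hbo⟩ : ∃ b, S b ∧ b ≠ o := by grind
    have hbe : b = e := by
      by_contra hbe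
      have := hconv o b e hSo hb trivial (by have := pos b o; have := pos b e; grind)
      grind
    have := hconv o b t hSo hb trivial (by have := inj b k; have := inj b o; have := inj b t; grind)
    grind

theorem simpleOn_delete_first (ho : (o : ℕ) = 0) (he : (e : ℕ) = 1) (hk : (k : ℕ) = 2)
    (hπo : (π o : ℕ) = 1) (hπk : (π k : ℕ) = 0) (hπt : (π t : ℕ) = 2) (hn : 3 < n)
    (ht : (t : ℕ) ≠ 3) (h : SimpleOn π (fun _ => True)) :
    SimpleOn π (fun x => x ≠ o) := by
  have inj : ∀ x y, (π x : ℕ) = π y → x = y := fun x y h => π.injective (Fin.ext h)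
  have pos : ∀ x y : Fin n, (x : ℕ) = y → x = y := fun x y h => Fin.ext h
  obtain ⟨d, hd⟩ : ∃ d : Fin n, (d : ℕ) = 3 := ⟨⟨3, hn⟩, rfl⟩
  rw [simpleOn_iff] at h ⊢
  intro S hS hconv a b c ha hb hab hc
  by_contra hSc
  have hSk : S k := by
    by_contra hSk
    refine hSc (h S (fun _ _ => trivial) (fun x y z hx hy _ hcut => ?_) a b c ha hb hab trivial)
    rcases eq_or_ne z o with rfl | hz
    · have := inj x k
      grind
    · exact hconv x y z hx hy hz hcut
  by_cases hSe : S e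
  · have := h (fun x => S x ∨ x = o) (fun _ _ => trivial) (fun x y z hx hy _ hcut => ?_) a b c
      (Or.inl ha) (Or.inl hb) hab trivial
    · grind
    · rcases eq_or_ne z o with rfl | hz
      · exact Or.inr rfl
      · left
        by_contra hSz
        have := pos z e
        have := pos z o
        have := inj z k
        have := hconv e y z hSe
        have := hconv k y z hSk
        have := hconv x y z
        grind
  · obtain ⟨y, hy, hyk⟩ : ∃ y, S y ∧ y ≠ k := by grind
    have hyd : y = d := by
      by_contra hyd
      have hyo := hS y hy
      have hye : y ≠ e := by rintro rfl; exact hSe hy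
      have := hconv k y d hSk hy (by grind) (by
        clear inj pos
        rw [Ne, Fin.ext_iff] at hyk hyo hye
        rw [Fin.ext_iff] at hyd
        simp only [Fin.lt_def]
        omega)
      have := h (fun x => S x ∧ x ≠ k) (fun _ _ => trivial) (fun x y z hx hy _ hcut => ?_) y d c
        (by grind) (by grind) hyd trivial
      · grind
      · have hzk : z ≠ k := by
          rintro rfl
          have := hS x hx.1
          have := pos x o
          have := pos x e
          grind
        have hzo : z ≠ o := by
          rintro rfl
          have := inj x k
          grind
        exact ⟨hconv x y z hx.1 hy.1 hzo hcut, hzk⟩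
    subst hyd
    have hSt := hconv k y t hSk hy (by grind) (by
      have := inj y k; have := inj y o; have := inj y t; grind)
    have := h (fun x => S x ∧ x ≠ k) (fun _ _ => trivial) (fun x y z hx hy _ hcut => ?_) y t c
      (by grind) (by grind) (by grind) trivial
    · grind
    · have hzk : z ≠ k := by
        rintro rfl
        have := hS x hx.1
        have := pos x o
        have := pos x e
        grind
      have hzo : z ≠ o := by
        rintro rfl
        have := inj x k
        grind
      exact ⟨hconv x y z hx.1 hy.1 hzo hcut, hzk⟩

end Deletion

theorem Fin.val_ne_or_eq {n : ℕ} (π : Equiv.Perm (Fin n)) (x y : Fin n) :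
    x = y ∨ (x ≠ y ∧ (x : ℕ) ≠ y ∧ (π x : ℕ) ≠ π y) := by
  by_cases h : x = y
  · exact Or.inl h
  · exact Or.inr ⟨h, fun h' => h (Fin.ext h'), fun h' => h (π.injective (Fin.ext h'))⟩

/-- In a simple set of points, the lowest point is neither the leftmost nor the rightmost one. -/
theorem SimpleOn.exists_left_right {n : ℕ} {π : Equiv.Perm (Fin n)} {T : Fin n → Prop}
    (h : SimpleOn π T) {t a b : Fin n} (ht : T t) (ha : T a) (hb : T b) (hab : a ≠ b)
    (hta : a ≠ t) (htb : b ≠ t) (hmin : ∀ x, T x → π t ≤ π x) :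
    (∃ l, T l ∧ l < t) ∧ ∃ r, T r ∧ t < r := by
  obtain ⟨x, y, z, ⟨hx, hxt⟩, ⟨hy, hyt⟩, hz, hzt, hcut⟩ :=
    h (fun x => T x ∧ x ≠ t) (fun x hx => hx.1) ⟨a, b, ⟨ha, hta⟩, ⟨hb, htb⟩, hab⟩
      ⟨t, ht, fun h => h.2 rfl⟩
  have hzt : z = t := by
    by_contra hne
    exact hzt ⟨hz, hne⟩
  subst hzt
  rcases hcut with hcut | hcut
  · exact ⟨⟨x, hx, hcut.1⟩, y, hy, hcut.2⟩
  · exact absurd hcut.1 (not_lt.2 (hmin x hx))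

section DeleteTwo

variable {n : ℕ} {π : Equiv.Perm (Fin n)} {o e k t w : Fin n}

/-- Inserting a new minimum next to the minimum of a simple permutation, and then a new first
entry with value `1`. -/
theorem simpleOn_of_delete_two (ho : (o : ℕ) = 0) (hπo : (π o : ℕ) = 1) (hπk : (π k : ℕ) = 0)
    (hπt : (π t : ℕ) = 2) (hkt : (k : ℕ) + 1 = t ∨ (t : ℕ) + 1 = k) (hn : 4 < n)
    (h : SimpleOn π (fun x => x ≠ o ∧ x ≠ k)) :
    SimpleOn π (fun _ => True) ∧ 2 ≤ (k : ℕ) ∧ 2 ≤ (t : ℕ) := by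
  have trich := Fin.val_ne_or_eq π
  obtain ⟨a, ha⟩ := π.surjective ⟨3, by omega⟩
  obtain ⟨b, hb⟩ := π.surjective ⟨4, by omega⟩
  have ha : (π a : ℕ) = 3 := by rw [ha]
  have hb : (π b : ℕ) = 4 := by rw [hb]
  obtain ⟨⟨l, ⟨hlo, hlk⟩, hlt⟩, r, ⟨hro, hrk⟩, htr⟩ := h.exists_left_right (t := t) (a := a) (b := b)
    (by grind) (by grind) (by grind) (by grind) (by grind) (by grind) (by
      intro x hx
      have h1 := trich x o
      have h2 := trich x k
      have h3 := trich x t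
      rw [Fin.le_def]
      omega)
  have h1 := trich l o
  have h2 := trich l k
  have h3 := trich l t
  have h4 := trich r k
  have hto : t ≠ o := by grind
  have htk : t ≠ k := by grind
  clear trich
  refine ⟨?_, by omega, by omega⟩
  rw [simpleOn_iff] at h ⊢
  intro S _ hconv a b c ha hb hab _
  by_cases hS : ∃ x y, S x ∧ S y ∧ (x ≠ o ∧ x ≠ k) ∧ (y ≠ o ∧ y ≠ k) ∧ x ≠ y
  · obtain ⟨x, y, hx, hy, hxT, hyT, hxy⟩ := hS
    have hall : ∀ c, (c ≠ o ∧ c ≠ k) → S c := fun c hc =>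
      (h (fun x => S x ∧ (x ≠ o ∧ x ≠ k)) (fun x hx => hx.2) (fun x y z hx hy hz hcut =>
        ⟨hconv x y z hx.1 hy.1 trivial hcut, hz⟩) x y c ⟨hx, hxT⟩ ⟨hy, hyT⟩ hxy hc).1
    have hSt := hall t ⟨hto, htk⟩
    have hSl := hall l ⟨hlo, hlk⟩
    have hSr := hall r ⟨hro, hrk⟩
    have hSk : S k := by
      rcases hkt with hkt | hkt
      · exact hconv l t k hSl hSt trivial (Or.inl ⟨by omega, by omega⟩)
      · exact hconv t r k hSt hSr trivial (Or.inl ⟨by omega, by omega⟩)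
    have hSo : S o := hconv k t o hSk hSt trivial (Or.inr ⟨by omega, by omega⟩)
    by_cases hc : c = o
    · exact hc ▸ hSo
    · by_cases hc' : c = k
      · exact hc' ▸ hSk
      · exact hall c ⟨hc, hc'⟩
  · exfalso
    have hlt' : l ≠ t := hlt.ne
    have hSlt : ¬ (S l ∧ S t) := fun h => hS ⟨l, t, h.1, h.2, ⟨hlo, hlk⟩, ⟨hto, htk⟩, hlt'⟩
    have hSo : S o := by
      by_contra hSo
      obtain ⟨b, hSk, hb, hbo, hbk⟩ : ∃ b, S k ∧ S b ∧ b ≠ o ∧ b ≠ k := by grind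
      have h1 := Fin.val_ne_or_eq π b o
      have h2 := Fin.val_ne_or_eq π b k
      exact hSo (hconv k b o hSk hb trivial (Or.inr ⟨by omega, by omega⟩))
    have hSk : ¬ S k := by
      intro hSk
      have hSl := hconv o k l hSo hSk trivial (Or.inl ⟨by omega, by omega⟩)
      exact hSlt ⟨hSl, hconv o l t hSo hSl trivial (Or.inr ⟨by omega, by omega⟩)⟩
    obtain ⟨b, hb, hbo⟩ : ∃ b, S b ∧ b ≠ o := by grind
    have hbk : b ≠ k := by rintro rfl; exact hSk hb
    have hSt : S t := by
      by_contra hSt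
      have h1 := Fin.val_ne_or_eq π b o
      have h2 := Fin.val_ne_or_eq π b k
      have h3 := Fin.val_ne_or_eq π b t
      have hbt : b ≠ t := by rintro rfl; exact hSt hb
      exact hSt (hconv o b t hSo hb trivial (Or.inr ⟨by omega, by omega⟩))
    exact hSlt ⟨hconv o t l hSo hSt trivial (Or.inl ⟨by omega, by omega⟩), hSt⟩

theorem simpleOn_delete_two (ho : (o : ℕ) = 0) (he : (e : ℕ) = 1) (hπo : (π o : ℕ) = 1)
    (hπk : (π k : ℕ) = 0) (hπt : (π t : ℕ) = 2) (hkt : (k : ℕ) + 1 = t ∨ (t : ℕ) + 1 = k)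
    (hk : 2 ≤ (k : ℕ)) (ht : 2 ≤ (t : ℕ)) (hcase : ((k : ℕ) = 2 ∧ (t : ℕ) = 3) ∨ (π e : ℕ) = 3)
    (h : SimpleOn π (fun _ => True)) : SimpleOn π (fun x => x ≠ o ∧ x ≠ k) := by
  have trich := Fin.val_ne_or_eq π
  have heo : e ≠ o := by grind
  have hek : e ≠ k := by grind
  have hto : t ≠ o := by grind
  have htk : t ≠ k := by grind
  have het : e ≠ t := by grind
  rw [simpleOn_iff] at h ⊢
  intro S hS hconv a b c ha hb hab hc
  by_contra hSc
  have hconvex : ¬ ∀ x y, S x → S y → x < k → k < y → False := by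
    intro hno
    refine hSc (h S (fun _ _ => trivial) (fun x y z hx hy _ hcut => ?_) a b c ha hb hab trivial)
    rcases trich z o with rfl | ⟨hzo, -⟩
    · have := trich x k
      have := (hS x hx).2
      exfalso
      simp only [Fin.lt_def] at hcut
      omega
    · rcases trich z k with rfl | ⟨hzk, -⟩
      · rcases hcut with hcut | hcut
        · exact (hno x y hx hy hcut.1 hcut.2).elim
        · simp only [Fin.lt_def] at hcut
          omega
      · exact hconv x y z hx hy ⟨hzo, hzk⟩ hcut
  push Not at hconvex
  obtain ⟨u, v, hu, hv, huk, hkv, -⟩ := hconvex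
  have hSt : S t := by
    by_contra hSt
    have hut : u ≠ t := by rintro rfl; exact hSt hu
    have hvt : v ≠ t := by rintro rfl; exact hSt hv
    have := trich u t
    have := trich v t
    exact hSt (hconv u v t hu hv ⟨hto, htk⟩ (Or.inl (by simp only [Fin.lt_def]; omega)))
  have hSe : S e := by
    rcases hcase with hcase | hcase
    · have := (hS u hu).1
      have := trich u o
      have := trich u e
      have hue : u = e := by omega
      exact hue ▸ hu
    · obtain ⟨y, hy, hyt⟩ : ∃ y, S y ∧ y ≠ t := by grind
      have := hS y hy
      have := trich y o
      have := trich y k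
      have := trich y t
      rcases trich y e with rfl | hye
      · exact hy
      · exact hconv t y e hSt hy ⟨heo, hek⟩ (Or.inr (by simp only [Fin.lt_def]; omega))
  have := h (fun x => S x ∨ x = o ∨ x = k) (fun _ _ => trivial) (fun x y z hx hy _ hcut => ?_) a b c
    (Or.inl ha) (Or.inl hb) hab trivial
  · rcases this with h | h | h
    · exact hSc h
    · exact hc.1 h
    · exact hc.2 h
  · by_cases hzo : z = o
    · exact Or.inr (Or.inl hzo)
    by_cases hzk : z = k
    · exact Or.inr (Or.inr hzk)
    left
    have h1 := trich z o
    have h2 := trich z k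
    rcases trich z t with rfl | h3
    · exact hSt
    rcases trich z e with rfl | h4
    · exact hSe
    simp only [Fin.lt_def] at hcut
    rcases hcut with hcut | hcut
    · rcases hy with hy | rfl | rfl
      · exact hconv e y z hSe hy ⟨hzo, hzk⟩ (Or.inl (by simp only [Fin.lt_def]; omega))
      · omega
      · exact hconv e t z hSe hSt ⟨hzo, hzk⟩ (Or.inl (by simp only [Fin.lt_def]; omega))
    · rcases hy with hy | rfl | rfl
      · exact hconv t y z hSt hy ⟨hzo, hzk⟩ (Or.inr (by simp only [Fin.lt_def]; omega))
      · omega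
      · omega

/-- Inserting an entry with value `2` next to the minimum of a simple permutation which starts
with `1`. -/
theorem simpleOn_of_delete_third (ho : (o : ℕ) = 0) (hπo : (π o : ℕ) = 1) (hπk : (π k : ℕ) = 0)
    (hπt : (π t : ℕ) = 2) (hπw : (π w : ℕ) = 3) (hkt : (k : ℕ) + 1 = t ∨ (t : ℕ) + 1 = k)
    (hw : (w : ℕ) + 1 ≠ t ∧ (t : ℕ) + 1 ≠ w) (h : SimpleOn π (fun x => x ≠ t)) :
    SimpleOn π (fun _ => True) ∧ (w : ℕ) ≠ 1 ∧ ((t : ℕ) + 1 = k → 2 < (k : ℕ)) := by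
  have trich := Fin.val_ne_or_eq π
  have hok : o ≠ k := by grind
  have hot : o ≠ t := by grind
  have how : o ≠ w := by grind
  have hkt' : k ≠ t := by grind
  have hkw : k ≠ w := by grind
  have hwt : w ≠ t := by grind
  obtain ⟨l, hlt, hl⟩ := h.exists_cut_pair hot hkt' hwt hok how hkw
  obtain ⟨l', hlt', hl'⟩ := h.exists_cut_pair hot hwt hkt' how hok hkw.symm
  have h1 := trich l t
  have h2 := trich l' t
  have h3 := trich w t
  simp only [Fin.lt_def] at hl hl'
  refine ⟨?_, by omega, by omega⟩
  rw [simpleOn_iff] at h ⊢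
  intro S _ hconv a b c ha hb hab _
  by_cases hS : ∃ x y, S x ∧ S y ∧ x ≠ t ∧ y ≠ t ∧ x ≠ y
  · obtain ⟨x, y, hx, hy, hxT, hyT, hxy⟩ := hS
    have hall : ∀ c, c ≠ t → S c := fun c hc =>
      (h (fun x => S x ∧ x ≠ t) (fun x hx => hx.2) (fun x y z hx hy hz hcut =>
        ⟨hconv x y z hx.1 hy.1 trivial hcut, hz⟩) x y c ⟨hx, hxT⟩ ⟨hy, hyT⟩ hxy hc).1
    by_cases hc : c = t
    · exact hc ▸ hconv o w t (hall o hot) (hall w hwt) trivial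
        (Or.inr (by simp only [Fin.lt_def]; omega))
    · exact hall c hc
  · exfalso
    have hS' : ∀ x y, S x → S y → x ≠ t → y ≠ t → x = y := by
      intro x y hx hy hxt hyt
      by_contra hxy
      exact hS ⟨x, y, hx, hy, hxt, hyt, hxy⟩
    have hSt : S t := by
      by_contra hSt
      exact hab (hS' a b ha hb (by rintro rfl; exact hSt ha) (by rintro rfl; exact hSt hb))
    obtain ⟨b, hb, hbt⟩ : ∃ b, S b ∧ b ≠ t := by
      by_cases hat : a = t
      · exact ⟨b, hb, fun h => hab (hat.trans h.symm)⟩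
      · exact ⟨a, ha, hat⟩
    have hbo : b ≠ o := by
      rintro rfl
      have hSl := hconv b t l hb hSt trivial (Or.inl (by simp only [Fin.lt_def]; omega))
      have := hS' b l hb hSl hot hlt
      have := congrArg Fin.val this
      omega
    have hbk : b ≠ k := by
      rintro rfl
      exact hbo (hS' _ _ hb (hconv b t o hb hSt trivial (Or.inr (by simp only [Fin.lt_def]; omega)))
        hbt hot)
    have hbw : b = w := by
      by_contra hbw
      have := trich b o
      have := trich b k
      have := trich b t
      have := trich b w
      exact hbw (hS' _ _ hb (hconv t b w hSt hb trivial (Or.inr (by simp only [Fin.lt_def]; omega)))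
        hbt hwt)
    subst hbw
    rcases lt_or_ge (b : ℕ) t with hlt | hlt
    · have := hconv b t ⟨b + 1, by omega⟩ hb hSt trivial (Or.inl (by simp only [Fin.lt_def]; omega))
      have := congrArg Fin.val (hS' _ _ hb this hbt (by rw [Ne, Fin.ext_iff]; exact hw.1))
      simp at this
    · have := hconv t b ⟨t + 1, by omega⟩ hSt hb trivial (Or.inl (by simp only [Fin.lt_def]; omega))
      have := congrArg Fin.val (hS' _ _ hb this hbt (by rw [Ne, Fin.ext_iff]; simp))
      simp at this
      omega

theorem simpleOn_delete_third (ho : (o : ℕ) = 0) (he : (e : ℕ) = 1) (hπo : (π o : ℕ) = 1)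
    (hπk : (π k : ℕ) = 0) (hπt : (π t : ℕ) = 2) (hπw : (π w : ℕ) = 3)
    (hkt : (k : ℕ) + 1 = t ∨ (t : ℕ) + 1 = k) (hk : 2 < (k : ℕ)) (hw : (w : ℕ) ≠ 1)
    (h : SimpleOn π (fun _ => True)) : SimpleOn π (fun x => x ≠ t) := by
  have trich := Fin.val_ne_or_eq π
  have heo : e ≠ o := by grind
  have hek : e ≠ k := by grind
  have hot : o ≠ t := by grind
  have how : o ≠ w := by grind
  have hkt' : k ≠ t := by grind
  have hwt : w ≠ t := by grind
  have het : e ≠ t := by grind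
  rw [simpleOn_iff] at h ⊢
  intro S hS hconv a b c ha hb hab hc
  by_contra hSc
  have hcutpos : ∀ x y, S x → S y → x < t → t < y → S k := by
    intro x y hx hy hxt hty
    rcases trich x k with rfl | h1
    · exact hx
    rcases trich y k with rfl | h2
    · exact hy
    exact hconv x y k hx hy hkt' (Or.inl (by simp only [Fin.lt_def] at *; omega))
  by_cases hSk : S k
  · have hSo : S o := by
      obtain ⟨y, hy, hyk⟩ : ∃ y, S y ∧ y ≠ k := by
        by_cases hak : a = k
        · exact ⟨b, hb, fun h => hab (hak.trans h.symm)⟩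
        · exact ⟨a, ha, hak⟩
      have := trich y k
      rcases trich y o with rfl | h1
      · exact hy
      · exact hconv k y o hSk hy hot (Or.inr (by simp only [Fin.lt_def]; omega))
    have := h (fun x => S x ∨ x = t) (fun _ _ => trivial) (fun x y z hx hy _ hcut => ?_) a b c
      (Or.inl ha) (Or.inl hb) hab trivial
    · exact this.elim hSc hc
    · by_cases hzt : z = t
      · exact Or.inr hzt
      left
      rcases trich z k with rfl | h1
      · exact hSk
      rcases trich z o with rfl | h2
      · exact hSo
      have h3 := trich z t
      simp only [Fin.lt_def] at hcut
      rcases hx with hx | rfl <;> rcases hy with hy | rfl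
      · exact hconv x y z hx hy hzt hcut
      · exact hconv x k z hx hSk hzt (Or.inl (by simp only [Fin.lt_def]; omega))
      · exact hconv k y z hSk hy hzt (by simp only [Fin.lt_def]; omega)
      · omega
  · have hno : ∀ x, S x → x ≠ o → x ≠ k ∧ 2 < (π x : ℕ) := by
      intro x hx hxo
      have h1 := hS x hx
      have h2 : x ≠ k := by rintro rfl; exact hSk hx
      have := trich x k
      have := trich x o
      have := trich x t
      exact ⟨h2, by omega⟩
    have hconvex : ConvexIn π (fun _ => True) (fun x => S x ∧ x ≠ o) := by
      rintro x y z ⟨hx, hxo⟩ ⟨hy, hyo⟩ _ hcut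
      have hzo : z ≠ o := by
        rintro rfl
        have := (hno x hx hxo).2
        simp only [Fin.lt_def] at hcut
        omega
      refine ⟨?_, hzo⟩
      rcases trich z t with rfl | ⟨hzt, -⟩
      · exfalso
        have := (hno x hx hxo).2
        rcases hcut with hcut | hcut
        · exact hSk (hcutpos x y hx hy hcut.1 hcut.2)
        · simp only [Fin.lt_def] at hcut
          omega
      · exact hconv x y z hx hy hzt hcut
    have huniq : ∀ x y, S x → S y → x ≠ o → y ≠ o → x = y := by
      intro x y hx hy hxo hyo
      by_contra hxy
      exact hSc (h _ (fun _ _ => trivial) hconvex x y c ⟨hx, hxo⟩ ⟨hy, hyo⟩ hxy trivial).1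
    have hSo : S o := by
      by_contra hSo
      exact hab (huniq a b ha hb (by rintro rfl; exact hSo ha) (by rintro rfl; exact hSo hb))
    obtain ⟨y, hy, hyo⟩ : ∃ y, S y ∧ y ≠ o := by
      by_cases hao : a = o
      · exact ⟨b, hb, fun h => hab (hao.trans h.symm)⟩
      · exact ⟨a, ha, hao⟩
    have hSw : S w := by
      have := hno y hy hyo
      rcases trich y w with rfl | h1
      · exact hy
      · exact hconv o y w hSo hy hwt (Or.inr (by simp only [Fin.lt_def]; omega))
    have h1 := trich o w
    have hSe := hconv o w e hSo hSw het (Or.inl (by simp only [Fin.lt_def]; omega))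
    have := congrArg Fin.val (huniq e w hSe hSw heo how.symm)
    omega

end DeleteTwo

/-- An occurrence of a robust pattern can be moved away from the first entry, if that has value
`1`, and from one of two neighbouring entries with values `0` and `2`. -/
theorem Robust.exists_occurrence {k n : ℕ} {τ : Equiv.Perm (Fin k)} {π : Equiv.Perm (Fin n)}
    (hτ : Robust τ) {f : Fin k → Fin n} (hf : StrictMono f)
    (hocc : ∀ i j, τ i < τ j ↔ π (f i) < π (f j)) {o : Fin n} (ho : (o : ℕ) = 0)
    (hπo : (π o : ℕ) = 1) :
    (∀ i, f i ≠ o) ∧ ∀ c d : Fin n, ((c : ℕ) + 1 = d ∨ (d : ℕ) + 1 = c) →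
      (((π c : ℕ) = 0 ∧ (π d : ℕ) = 2) ∨ ((π c : ℕ) = 2 ∧ (π d : ℕ) = 0)) →
      ∃ g : Fin k → Fin n, StrictMono g ∧ (∀ i j, τ i < τ j ↔ π (g i) < π (g j)) ∧
        ∀ i, g i ≠ o ∧ g i ≠ c := by
  have htwo : ∀ i, 1 < (τ i : ℕ) → ∃ x y, π (f x) < π (f y) ∧ π (f y) < π (f i) := by
    intro i hi
    have hk := (τ i).2
    refine ⟨τ.symm ⟨0, by omega⟩, τ.symm ⟨1, by omega⟩, ?_, ?_⟩
    · rw [← hocc]; simp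
    · rw [← hocc, Equiv.apply_symm_apply, Fin.lt_def]; exact hi
  have hfo : ∀ i, f i ≠ o := by
    intro i hi
    have hi0 : (i : ℕ) = 0 := by
      by_contra h
      have := hf (show (⟨0, by omega⟩ : Fin k) < i from Nat.pos_of_ne_zero h)
      rw [hi, Fin.lt_def] at this
      omega
    obtain ⟨x, y, hxy, hyi⟩ := htwo i (hτ.one_lt_first i hi0)
    rw [hi] at hyi
    simp only [Fin.lt_def] at hxy hyi
    omega
  refine ⟨hfo, fun c d hcd hval => ?_⟩
  by_cases hc : ∃ i, f i = c
  swap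
  · exact ⟨f, hf, hocc, fun i => ⟨hfo i, fun h => hc ⟨i, h⟩⟩⟩
  obtain ⟨i, hi⟩ := hc
  have hzero : ∀ i, (π (f i) : ℕ) = 0 → (τ i : ℕ) = 0 := by
    intro i hi
    by_contra h
    have hk := (τ i).2
    have := (hocc (τ.symm ⟨0, by omega⟩) i).1 (by
      rw [Equiv.apply_symm_apply, Fin.lt_def]; exact Nat.pos_of_ne_zero h)
    rw [Fin.lt_def] at this
    omega
  have htwo' : ∀ i, (π (f i) : ℕ) = 2 → (τ i : ℕ) ≤ 1 := by
    intro i hi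
    by_contra h
    obtain ⟨x, y, hxy, hyi⟩ := htwo i (by omega)
    simp only [Fin.lt_def] at hxy hyi
    exact hfo y (π.injective (Fin.ext (by omega)))
  have hd : ∀ j, f j ≠ d := by
    intro j hj
    have hadj : (i : ℕ) + 1 = j ∨ (j : ℕ) + 1 = i := by
      have hmono : ∀ x y : Fin k, x < y → ((f x : ℕ) + 1 = f y) → (x : ℕ) + 1 = y := by
        intro x y hxy h
        by_contra hne
        have h1 := @hf x ⟨x + 1, by omega⟩ (by rw [Fin.lt_def]; simp)
        have h2 := @hf ⟨x + 1, by omega⟩ y (by rw [Fin.lt_def] at *; simp; omega)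
        rw [Fin.lt_def] at h1 h2
        omega
      rcases hcd with h | h
      · exact Or.inl (hmono i j (hf.lt_iff_lt.1 (by rw [hi, hj, Fin.lt_def]; omega)) (by rw [hi, hj, h]))
      · exact Or.inr (hmono j i (hf.lt_iff_lt.1 (by rw [hi, hj, Fin.lt_def]; omega)) (by rw [hi, hj, h]))
    have hij : τ i ≠ τ j := by
      rw [τ.injective.ne_iff]
      rintro rfl
      rw [hi] at hj
      subst hj
      omega
    rw [Ne, Fin.ext_iff] at hij
    rcases hval with ⟨h0, h2⟩ | ⟨h2, h0⟩
    · have h3 := hzero i (by rw [hi, h0])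
      have h4 := htwo' j (by rw [hj, h2])
      have := hτ.not_adjacent i j h3 (by omega)
      omega
    · have h3 := hzero j (by rw [hj, h0])
      have h4 := htwo' i (by rw [hi, h2])
      have := hτ.not_adjacent j i h3 (by omega)
      omega
  have hcmp : ∀ j, j ≠ i → (f j < c ↔ f j < d) ∧ (c < f j ↔ d < f j) ∧
      (π (f j) < π c ↔ π (f j) < π d) ∧ (π c < π (f j) ↔ π d < π (f j)) := by
    intro j hji
    have h1 := Fin.val_ne_or_eq π (f j) o
    have h2 := Fin.val_ne_or_eq π (f j) d
    have h3 := Fin.val_ne_or_eq π (f j) c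
    have h4 := hfo j
    have h5 := hd j
    have h6 : f j ≠ c := by rw [← hi]; exact hf.injective.ne hji
    simp only [Fin.lt_def]
    omega
  refine ⟨Function.update f i d, ?_, ?_, ?_⟩
  · intro x y hxy
    have := hf hxy
    by_cases hx : x = i
    · subst hx
      rw [Function.update_self, Function.update_of_ne hxy.ne']
      rw [hi] at this
      exact (hcmp y hxy.ne').2.1.1 this
    · by_cases hy : y = i
      · subst hy
        rw [Function.update_self, Function.update_of_ne hx]
        rw [hi] at this
        exact (hcmp x hx).1.1 this
      · rwa [Function.update_of_ne hx, Function.update_of_ne hy]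
  · intro x y
    by_cases hx : x = i
    · subst hx
      by_cases hy : y = x
      · subst hy
        simp
      · rw [Function.update_self, Function.update_of_ne hy, hocc, hi]
        exact (hcmp y hy).2.2.2
    · by_cases hy : y = i
      · subst hy
        rw [Function.update_self, Function.update_of_ne hx, hocc, hi]
        exact (hcmp x hx).2.2.1
      · rw [Function.update_of_ne hx, Function.update_of_ne hy, hocc]
  · intro x
    by_cases hx : x = i
    · subst hx
      rw [Function.update_self]
      constructor
      · rintro rfl; omega
      · rintro rfl; omega
    · rw [Function.update_of_ne hx]
      exact ⟨hfo x, by rw [← hi]; exact hf.injective.ne hx⟩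

/-- Insert the value `v` at position `p` into the permutation `σ`. -/
def ins {n : ℕ} (p v : Fin (n + 1)) (σ : Equiv.Perm (Fin n)) : Equiv.Perm (Fin (n + 1)) :=
  (finSuccEquiv' p).trans (σ.optionCongr.trans (finSuccEquiv' v).symm)

section Ins

variable {n : ℕ} {p v : Fin (n + 1)} {σ : Equiv.Perm (Fin n)}

@[simp]
theorem ins_apply_self : ins p v σ p = v := by
  simp [ins]

@[simp]
theorem ins_apply_succAbove (i : Fin n) : ins p v σ (p.succAbove i) = v.succAbove (σ i) := by
  simp [ins]

theorem val_succAbove (i : Fin n) :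
    ((i : ℕ) < p ∧ (p.succAbove i : ℕ) = i) ∨ ((p : ℕ) ≤ i ∧ (p.succAbove i : ℕ) = i + 1) := by
  rcases lt_or_ge i.castSucc p with h | h
  · left
    rw [Fin.succAbove_of_castSucc_lt _ _ h]
    exact ⟨h, rfl⟩
  · right
    rw [Fin.succAbove_of_le_castSucc _ _ h]
    exact ⟨h, rfl⟩

theorem ins_lt_iff (i j : Fin n) :
    σ i < σ j ↔ ins p v σ (p.succAbove i) < ins p v σ (p.succAbove j) := by
  simp [(Fin.strictMono_succAbove v).lt_iff_lt]

theorem ne_iff_exists_succAbove (x : Fin (n + 1)) : x ≠ p ↔ ∃ i, p.succAbove i = x := by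
  rw [Fin.exists_succAbove_eq_iff]

theorem exists_eq_ins (π : Equiv.Perm (Fin (n + 1))) (p : Fin (n + 1)) :
    ∃ σ, π = ins p (π p) σ := by
  have h : ∀ i, ∃ j, (π p).succAbove j = π (p.succAbove i) := fun i => by
    rw [Fin.exists_succAbove_eq_iff]
    exact π.injective.ne (Fin.succAbove_ne p i)
  choose f hf using h
  have hinj : Function.Injective f := fun i j hij =>
    Fin.succAbove_right_injective (π.injective (by rw [← hf, ← hf, hij]))
  refine ⟨Equiv.ofBijective f (Finite.injective_iff_bijective.1 hinj), Equiv.ext fun x => ?_⟩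
  by_cases hx : x = p
  · simp [hx]
  · obtain ⟨i, rfl⟩ := (ne_iff_exists_succAbove x).1 hx
    rw [ins_apply_succAbove, ← hf]
    rfl

theorem eq_of_ins_eq {p' : Fin (n + 1)} {σ' : Equiv.Perm (Fin n)}
    (h : ins p v σ = ins p' v σ') : σ = σ' := by
  have hp : p = p' := (ins p v σ).injective (by rw [ins_apply_self, h, ins_apply_self])
  subst hp
  refine Equiv.ext fun i => ?_
  have := DFunLike.congr_fun h (p.succAbove i)
  simpa using this

end Ins

section Insertion

theorem at_ins_iff {n : ℕ} {p v : Fin (n + 1)} {σ : Equiv.Perm (Fin n)} {i w i' w' : ℕ}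
    (hi : (i < p ∧ i' = i) ∨ ((p : ℕ) ≤ i ∧ i' = i + 1))
    (hw : (w < v ∧ w' = w) ∨ ((v : ℕ) ≤ w ∧ w' = w + 1)) :
    At (ins p v σ) i' w' ↔ At σ i w := by
  constructor
  · intro h
    obtain ⟨x, hx, hx'⟩ := h.obtain
    obtain ⟨j, rfl⟩ := (ne_iff_exists_succAbove (p := p) x).1 (by
      rintro rfl
      omega)
    have h1 := val_succAbove (p := p) j
    have h2 := val_succAbove (p := v) (σ j)
    rw [ins_apply_succAbove] at hx'
    exact At.mk j (by omega) (by omega)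
  · intro h
    obtain ⟨j, hj, hj'⟩ := h.obtain
    have h1 := val_succAbove (p := p) j
    have h2 := val_succAbove (p := v) (σ j)
    exact At.mk (p.succAbove j) (by omega) (by rw [ins_apply_succAbove]; omega)

theorem at_ins_self {n : ℕ} {p v : Fin (n + 1)} {σ : Equiv.Perm (Fin n)} {i w : ℕ}
    (hi : (p : ℕ) = i) (hw : (v : ℕ) = w) : At (ins p v σ) i w :=
  At.mk p hi (by rw [ins_apply_self, hw])

theorem at_symm_zero {n : ℕ} (σ : Equiv.Perm (Fin (n + 1))) : At σ (σ.symm 0) 0 :=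
  At.mk (σ.symm 0) rfl (by simp)

theorem exists_eq_ins_of_at {n i : ℕ} {π : Equiv.Perm (Fin (n + 1))} {v : Fin (n + 1)}
    (h : At π i v) : ∃ (p : Fin (n + 1)) (σ : Equiv.Perm (Fin n)), (p : ℕ) = i ∧ π = ins p v σ := by
  obtain ⟨x, hx, hx'⟩ := h.obtain
  obtain ⟨σ, hσ⟩ := exists_eq_ins π x
  exact ⟨x, σ, hx, by rw [Fin.ext hx'] at hσ; exact hσ⟩

theorem isSimple_iff_simpleOn_ins {n : ℕ} {p v : Fin (n + 1)} {σ : Equiv.Perm (Fin n)} :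
    IsSimple σ ↔ SimpleOn (ins p v σ) (fun x => x ≠ p) :=
  isSimple_iff_simpleOn_of_occurrence (Fin.strictMono_succAbove p) ins_lt_iff
    ne_iff_exists_succAbove

theorem InA.of_ins {n : ℕ} {p v : Fin (n + 1)} {σ : Equiv.Perm (Fin n)} (h : InA (ins p v σ)) :
    InA σ :=
  h.of_occurrence (Fin.strictMono_succAbove p) ins_lt_iff

/-- The simple permutations in the class. -/
def simpleA (n : ℕ) : Set (Equiv.Perm (Fin n)) := {π | IsSimple π ∧ InA π}

/-- The simple permutations in the class whose first entry is the second smallest one. -/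
def simpleAOne (n : ℕ) : Set (Equiv.Perm (Fin n)) := {π | IsSimple π ∧ InA π ∧ At π 0 1}

theorem IsSimple.exists_cut_pair {n : ℕ} {π : Equiv.Perm (Fin n)} (h : IsSimple π) (hn : 2 < n)
    {a b : Fin n} (hab : a ≠ b) :
    ∃ z, (a < z ∧ z < b) ∨ (b < z ∧ z < a) ∨ (π a < π z ∧ π z < π b) ∨
      (π b < π z ∧ π z < π a) := by
  obtain ⟨c, hac, hbc⟩ : ∃ c, a ≠ c ∧ b ≠ c := by
    by_contra hno
    push Not at hno
    have := Finset.card_le_card (fun c _ => by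
      by_cases hc : a = c
      · simp [hc]
      · simp [hno c hc] : (Finset.univ : Finset (Fin n)) ⊆ {a, b})
    have h2 := Finset.card_le_two (a := a) (b := b)
    rw [Finset.card_univ, Fintype.card_fin] at this
    omega
  obtain ⟨z, -, hz⟩ := ((isSimple_iff_simpleOn π).1 h).exists_cut_pair trivial trivial trivial
    hab hac hbc
  exact ⟨z, hz⟩

/-- Adjacent entries of a simple permutation do not have adjacent values. -/
theorem IsSimple.not_adjacent {n : ℕ} {π : Equiv.Perm (Fin n)} (h : IsSimple π) (hn : 2 < n)
    {i v w : ℕ} (hv : At π i v) (hw : At π (i + 1) w) : v + 1 ≠ w ∧ w + 1 ≠ v := by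
  obtain ⟨a, ha, ha'⟩ := hv.obtain
  obtain ⟨b, hb, hb'⟩ := hw.obtain
  obtain ⟨z, hz⟩ := h.exists_cut_pair hn (a := a) (b := b) (by rintro rfl; omega)
  simp only [Fin.lt_def] at hz
  omega

theorem ncard_eq_of_bijOn {α β : Type*} {s : Set α} {t : Set β} {f : α → β}
    (hf : Function.Injective f) (hst : ∀ x ∈ s, f x ∈ t) (hts : ∀ y ∈ t, ∃ x ∈ s, f x = y) :
    t.ncard = s.ncard := by
  rw [← Set.ncard_image_of_injective s hf]
  congr 1
  ext y
  constructor
  · intro hy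
    obtain ⟨x, hx, rfl⟩ := hts y hy
    exact ⟨x, hx, rfl⟩
  · rintro ⟨x, hx, rfl⟩
    exact hst x hx

theorem insert_first_iff {m : ℕ} {σ : Equiv.Perm (Fin (m + 4))} :
    (IsSimple (ins 0 1 σ) ∧ InA (ins 0 1 σ) ∧ At (ins 0 1 σ) 2 0 ∧ ¬ At (ins 0 1 σ) 3 2) ↔
      IsSimple σ ∧ InA σ ∧ At σ 1 0 := by
  have hat : At (ins 0 1 σ) 2 0 ↔ At σ 1 0 := at_ins_iff (by simp) (by simp)
  obtain ⟨i, ht⟩ := exists_at (ins 0 1 σ) (v := 2) (by omega)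
  obtain ⟨t, hti, ht⟩ := ht.obtain
  rw [isSimple_iff_simpleOn, isSimple_iff_simpleOn_ins (p := 0) (v := 1)]
  have hself : ((ins 0 1 σ) 0 : ℕ) = 1 := by rw [ins_apply_self]; rfl
  constructor
  · rintro ⟨hs, hA, hk, h3⟩
    obtain ⟨k, hk2, hk⟩ := hk.obtain
    refine ⟨simpleOn_delete_first (e := 1) (k := k) (t := t) rfl rfl hk2 hself hk ht (by omega)
      (fun h => h3 (At.mk t h ht)) hs, hA.of_ins, hat.1 (At.mk k hk2 hk)⟩
  · rintro ⟨hs, hA, hk⟩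
    have hk' := hat.2 hk
    obtain ⟨k, hk2, hk⟩ := hk'.obtain
    obtain ⟨h1, h2⟩ := simpleOn_of_delete_first (e := 1) (k := k) (t := t) rfl rfl hk2 hself hk ht
      (by omega) hs
    refine ⟨h1, inA_of_robust (fun k τ hτ ⟨f, hf, hocc⟩ => contains_of_occurrence
      (Fin.strictMono_succAbove 0) ins_lt_iff ne_iff_exists_succAbove hf hocc
      (hτ.exists_occurrence hf hocc rfl hself).1) hA, hk', fun h => h2 ?_⟩
    exact (At.mk t rfl ht).pos_unique h

theorem ncard_insert_first (m : ℕ) :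
    {π | π ∈ simpleAOne (m + 5) ∧ At π 2 0 ∧ ¬ At π 3 2}.ncard = (simpleAOne (m + 4)).ncard := by
  refine ncard_eq_of_bijOn (f := fun σ => ins 0 1 σ.symm)
    (fun σ σ' h => Equiv.symm_bijective.injective (eq_of_ins_eq h)) ?_ ?_
  · rintro σ ⟨hs, hA, h01⟩
    obtain ⟨x, hx, hx'⟩ := h01.obtain
    obtain ⟨h1, h2, h3, h4⟩ := insert_first_iff.2 ⟨hs.symm, hA.symm,
      At.mk (σ x) hx' (by rw [Equiv.symm_apply_apply, hx])⟩
    exact ⟨⟨h1, h2, at_ins_self rfl rfl⟩, h3, h4⟩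
  · rintro π ⟨⟨hs, hA, h01⟩, h2, h3⟩
    obtain ⟨p, σ, hp, rfl⟩ := exists_eq_ins_of_at (v := 1) h01
    obtain rfl : p = 0 := Fin.ext hp
    obtain ⟨hs, hA, h10⟩ := insert_first_iff.1 ⟨hs, hA, h2, h3⟩
    obtain ⟨x, hx, hx'⟩ := h10.obtain
    exact ⟨σ.symm, ⟨hs.symm, hA.symm, At.mk (σ x) hx' (by rw [Equiv.symm_apply_apply, hx])⟩,
      by simp⟩

section InsertTwo

variable {m : ℕ} {σ : Equiv.Perm (Fin (m + 3))} {q : Fin (m + 4)} {t : ℕ}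

theorem insert_two_lt_iff (i j : Fin (m + 3)) : σ i < σ j ↔
    ins 0 1 (ins q 0 σ) (Fin.succ (q.succAbove i)) <
      ins 0 1 (ins q 0 σ) (Fin.succ (q.succAbove j)) := by
  rw [ins_lt_iff (p := q) (v := 0), ins_lt_iff (p := 0) (v := 1)]
  simp only [Fin.succAbove_zero]

theorem ne_and_ne_iff_exists (x : Fin (m + 5)) :
    (x ≠ 0 ∧ x ≠ q.succ) ↔ ∃ i, Fin.succ (q.succAbove i) = x := by
  constructor
  · rintro ⟨h0, hq⟩
    obtain ⟨y, rfl⟩ := Fin.exists_succ_eq.2 h0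
    obtain ⟨i, rfl⟩ := (ne_iff_exists_succAbove (p := q) y).1 (fun h => hq (by rw [h]))
    exact ⟨i, rfl⟩
  · rintro ⟨i, rfl⟩
    exact ⟨Fin.succ_ne_zero _, fun h => Fin.succAbove_ne q i (Fin.succ_injective _ h)⟩

theorem strictMono_insert_two :
    StrictMono (fun i : Fin (m + 3) => Fin.succ (q.succAbove i)) :=
  (Fin.strictMono_succ).comp (Fin.strictMono_succAbove q)

theorem at_insert_two : At (ins 0 1 (ins q 0 σ)) (q + 1) 0 :=
  (at_ins_iff (by simp) (by simp)).2 (at_ins_self rfl rfl)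

theorem isSimple_insert_two (ht : At (ins 0 1 (ins q 0 σ)) t 2)
    (hqt : (q : ℕ) + 2 = t ∨ t = q) (hs : IsSimple σ) (hA : InA σ) :
    IsSimple (ins 0 1 (ins q 0 σ)) ∧ InA (ins 0 1 (ins q 0 σ)) ∧ 1 ≤ (q : ℕ) ∧ 2 ≤ t := by
  obtain ⟨t, rfl, hπt⟩ := ht.obtain
  have hself : (ins 0 1 (ins q 0 σ) 0 : ℕ) = 1 := by rw [ins_apply_self]; rfl
  have hk : (ins 0 1 (ins q 0 σ) q.succ : ℕ) = 0 := at_insert_two.2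
  have hqt' : (q.succ : ℕ) + 1 = t ∨ (t : ℕ) + 1 = q.succ := by rw [Fin.val_succ]; omega
  rw [isSimple_iff_simpleOn_of_occurrence strictMono_insert_two (insert_two_lt_iff (q := q))
    ne_and_ne_iff_exists] at hs
  obtain ⟨h1, h2, h3⟩ := simpleOn_of_delete_two rfl hself hk hπt hqt' (by omega) hs
  rw [Fin.val_succ] at h2
  refine ⟨(isSimple_iff_simpleOn _).2 h1, inA_of_robust (fun k τ hτ ⟨f, hf, hocc⟩ => ?_) hA,
    by omega, h3⟩
  obtain ⟨g, hg, hg', hgT⟩ := (hτ.exists_occurrence hf hocc rfl hself).2 q.succ t hqt'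
    (Or.inl ⟨hk, hπt⟩)
  exact contains_of_occurrence strictMono_insert_two insert_two_lt_iff ne_and_ne_iff_exists hg hg'
    hgT

theorem isSimple_of_insert_two (ht : At (ins 0 1 (ins q 0 σ)) t 2)
    (hqt : (q : ℕ) + 2 = t ∨ t = q) (hcase : ((q : ℕ) = 1 ∧ t = 3) ∨ At (ins 0 1 (ins q 0 σ)) 1 3)
    (hs : IsSimple (ins 0 1 (ins q 0 σ))) (hA : InA (ins 0 1 (ins q 0 σ))) :
    IsSimple σ ∧ InA σ ∧ 1 ≤ (q : ℕ) := by
  have hq : 1 ≤ (q : ℕ) := by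
    by_contra hq
    have := (hs.not_adjacent (by omega) (i := 0) (v := 1) (w := 0) (at_ins_self rfl rfl) (by
      have := at_insert_two (σ := σ) (q := q)
      rwa [show (q : ℕ) = 0 by omega] at this)).2
    omega
  have ht1 : t ≠ 1 := by
    rintro rfl
    have := (hs.not_adjacent (by omega) (i := 0) (at_ins_self rfl rfl) ht).1
    exact this rfl
  obtain ⟨t, rfl, hπt⟩ := ht.obtain
  have hself : (ins 0 1 (ins q 0 σ) 0 : ℕ) = 1 := by rw [ins_apply_self]; rfl
  have hk : (ins 0 1 (ins q 0 σ) q.succ : ℕ) = 0 := at_insert_two.2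
  refine ⟨?_, hA.of_ins.of_ins, hq⟩
  rw [isSimple_iff_simpleOn_of_occurrence strictMono_insert_two (insert_two_lt_iff (q := q))
    ne_and_ne_iff_exists]
  refine simpleOn_delete_two (e := 1) rfl rfl hself hk hπt (by rw [Fin.val_succ]; omega)
    (by rw [Fin.val_succ]; omega) (by omega) ?_ ((isSimple_iff_simpleOn _).1 hs)
  rw [Fin.val_succ]
  exact hcase.imp (fun h => by omega) (fun h => h.2)

end InsertTwo

theorem ncard_insert_two_before (m : ℕ) :
    {π | π ∈ simpleAOne (m + 5) ∧ ∃ k, At π k 0 ∧ At π (k + 1) 2 ∧ (k = 2 ∨ At π 1 3)}.ncard =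
      (simpleA (m + 3)).ncard := by
  refine ncard_eq_of_bijOn (f := fun σ => ins 0 1 (ins (σ.symm 0).castSucc 0 σ))
    (fun σ σ' h => eq_of_ins_eq (eq_of_ins_eq h)) ?_ ?_
  · rintro σ ⟨hs, hA⟩
    have hk := at_symm_zero σ
    have ht : At (ins 0 1 (ins (σ.symm 0).castSucc 0 σ)) ((σ.symm 0).castSucc + 2) 2 :=
      (at_ins_iff (i := (σ.symm 0).castSucc + 1) (w := 1) (by simp) (by simp)).2
        ((at_ins_iff (by simp) (by simp)).2 hk)
    obtain ⟨h1, h2, h3, -⟩ := isSimple_insert_two ht (Or.inl rfl) hs hA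
    refine ⟨⟨h1, h2, at_ins_self rfl rfl⟩, _, at_insert_two, ht, ?_⟩
    rw [Fin.val_castSucc] at h3 ⊢
    rcases hs.first_or_second hA (o := 0) (k := σ.symm 0) rfl (by simp) with h | h
    · right
      have h0 : (σ 0 : ℕ) ≠ 0 := fun h => by
        have := (At.mk 0 rfl h : At σ 0 0).pos_unique hk
        omega
      refine (at_ins_iff (i := 0) (w := 2) (by simp) (by simp)).2
        ((at_ins_iff (i := 0) (w := 1) (by rw [Fin.val_castSucc]; omega) (by simp)).2
          (At.mk 0 rfl (by omega)))
    · left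
      omega
  · rintro π ⟨⟨hs, hA, h01⟩, k, hk, ht, hcase⟩
    obtain ⟨p, ρ, hp, rfl⟩ := exists_eq_ins_of_at (v := 1) h01
    obtain rfl : p = 0 := Fin.ext hp
    obtain ⟨q, σ, hq, rfl⟩ := exists_eq_ins_of_at (v := 0) (at_symm_zero ρ)
    obtain rfl : k = q + 1 := hk.pos_unique at_insert_two
    obtain ⟨h1, h2, h3⟩ := isSimple_of_insert_two ht (Or.inl rfl)
      (hcase.imp_left (fun h => by omega)) hs hA
    refine ⟨σ, ⟨h1, h2⟩, ?_⟩
    have h0 : At σ q 0 := (at_ins_iff (by simp) (by simp)).1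
      ((at_ins_iff (i := q + 1) (w := 1) (by simp) (by simp)).1 ht)
    have hq' : (σ.symm 0).castSucc = q := Fin.ext ((at_symm_zero σ).pos_unique h0)
    simp only [hq']

theorem ncard_insert_two_after (m : ℕ) :
    {π | π ∈ simpleAOne (m + 5) ∧ At π 1 3 ∧ ∃ k, At π k 2 ∧ At π (k + 1) 0}.ncard =
      (simpleAOne (m + 3)).ncard := by
  refine ncard_eq_of_bijOn (f := fun σ => ins 0 1 (ins (σ.symm 0).succ 0 σ))
    (fun σ σ' h => eq_of_ins_eq (eq_of_ins_eq h)) ?_ ?_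
  · rintro σ ⟨hs, hA, h01⟩
    have hk := at_symm_zero σ
    have ht : At (ins 0 1 (ins (σ.symm 0).succ 0 σ)) ((σ.symm 0).succ) 2 :=
      (at_ins_iff (i := σ.symm 0) (w := 1) (by simp) (by simp)).2
        ((at_ins_iff (by simp) (by simp)).2 hk)
    obtain ⟨h1, h2, h3, -⟩ := isSimple_insert_two ht (Or.inr rfl) hs hA
    refine ⟨⟨h1, h2, at_ins_self rfl rfl⟩, ?_, _, ht, at_insert_two⟩
    exact (at_ins_iff (i := 0) (w := 2) (by simp) (by simp)).2
        ((at_ins_iff (i := 0) (w := 1) (by simp) (by simp)).2 h01)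
  · rintro π ⟨⟨hs, hA, h01⟩, h13, k, ht, hk⟩
    obtain ⟨p, ρ, hp, rfl⟩ := exists_eq_ins_of_at (v := 1) h01
    obtain rfl : p = 0 := Fin.ext hp
    obtain ⟨q, σ, hq, rfl⟩ := exists_eq_ins_of_at (v := 0) (at_symm_zero ρ)
    obtain rfl : k = q := Nat.succ_injective (hk.pos_unique at_insert_two)
    obtain ⟨h1, h2, h3⟩ := isSimple_of_insert_two ht (Or.inr rfl) (Or.inr h13) hs hA
    have h0 : At σ (q - 1) 0 := (at_ins_iff (i' := q - 1) (w' := 1) (by omega) (by simp)).1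
      ((at_ins_iff (by simp; omega) (by simp)).1 ht)
    have hq' : (σ.symm 0).succ = q := Fin.ext (by
      have := (at_symm_zero σ).pos_unique h0
      rw [Fin.val_succ]
      omega)
    refine ⟨σ, ⟨h1, h2, ?_⟩, by simp only [hq']⟩
    exact (at_ins_iff (i' := 0) (w' := 2) (by omega) (by simp)).1
      ((at_ins_iff (by simp) (by simp)).1 h13)

/-- The value `2` stands immediately before the minimum. -/
def TwoBeforeZero {n : ℕ} (σ : Equiv.Perm (Fin n)) : Prop :=
  ∃ j, At σ j 2 ∧ At σ (j + 1) 0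

open scoped Classical in
/-- The position next to the minimum at which the value `2` is inserted. -/
noncomputable def thirdPos {m : ℕ} (σ : Equiv.Perm (Fin (m + 4))) : Fin (m + 5) :=
  if TwoBeforeZero σ then (σ.symm 0).succ else (σ.symm 0).castSucc

section InsertThird

variable {m : ℕ} {σ : Equiv.Perm (Fin (m + 4))} {p : Fin (m + 5)} {k w : ℕ}

theorem isSimple_insert_third (h01 : At (ins p 2 σ) 0 1) (hk : At (ins p 2 σ) k 0)
    (hw : At (ins p 2 σ) w 3) (hkp : k + 1 = p ∨ (p : ℕ) + 1 = k)
    (hwp : w + 1 ≠ p ∧ (p : ℕ) + 1 ≠ w) (hs : IsSimple σ) (hA : InA σ) :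
    IsSimple (ins p 2 σ) ∧ InA (ins p 2 σ) ∧ w ≠ 1 ∧ ((p : ℕ) + 1 = k → 2 < k) := by
  obtain ⟨o, ho, hπo⟩ := h01.obtain
  obtain ⟨k, rfl, hπk⟩ := hk.obtain
  obtain ⟨w, rfl, hπw⟩ := hw.obtain
  have hself : (ins p 2 σ p : ℕ) = 2 := by rw [ins_apply_self]; rfl
  obtain ⟨h1, h2, h3⟩ := simpleOn_of_delete_third ho hπo hπk hself hπw hkp hwp
    (isSimple_iff_simpleOn_ins.1 hs)
  refine ⟨(isSimple_iff_simpleOn _).2 h1, inA_of_robust (fun r τ hτ ⟨f, hf, hocc⟩ => ?_) hA, h2, h3⟩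
  obtain ⟨g, hg, hg', hgT⟩ := (hτ.exists_occurrence hf hocc ho hπo).2 p k hkp.symm
    (Or.inr ⟨hself, hπk⟩)
  exact contains_of_occurrence (Fin.strictMono_succAbove p) ins_lt_iff ne_iff_exists_succAbove
    hg hg' fun i => (hgT i).2

theorem isSimple_of_insert_third (h01 : At (ins p 2 σ) 0 1) (hk : At (ins p 2 σ) k 0)
    (h13 : ¬ At (ins p 2 σ) 1 3) (hkp : k + 1 = p ∨ (p : ℕ) + 1 = k) (hk2 : 2 < k)
    (hs : IsSimple (ins p 2 σ)) (hA : InA (ins p 2 σ)) : IsSimple σ ∧ InA σ ∧ At σ 0 1 := by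
  have hval : ((2 : Fin (m + 5)) : ℕ) = 2 := rfl
  refine ⟨?_, hA.of_ins, (at_ins_iff (by omega) (by omega)).1 h01⟩
  obtain ⟨w, hw⟩ := exists_at (ins p 2 σ) (v := 3) (by omega)
  obtain ⟨o, ho, hπo⟩ := h01.obtain
  obtain ⟨k, rfl, hπk⟩ := hk.obtain
  obtain ⟨w, rfl, hπw⟩ := hw.obtain
  have hself : (ins p 2 σ p : ℕ) = 2 := by rw [ins_apply_self]; rfl
  exact isSimple_iff_simpleOn_ins.2 (simpleOn_delete_third (e := 1) ho rfl hπo hπk hself hπw hkp hk2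
    (fun h => h13 (At.mk w h hπw)) ((isSimple_iff_simpleOn _).1 hs))

end InsertThird

theorem ncard_insert_third (m : ℕ) :
    {π | π ∈ simpleAOne (m + 5) ∧ ¬ At π 1 3 ∧ ¬ At π 2 0 ∧
      ∃ k, At π (k + 1) 0 ∧ (At π k 2 ∨ (At π (k + 2) 2 ∧ At π k 3))}.ncard =
      (simpleAOne (m + 4)).ncard := by
  refine ncard_eq_of_bijOn (f := fun σ => ins (thirdPos σ) 2 σ)
    (fun σ σ' h => eq_of_ins_eq h) ?_ ?_
  · rintro σ ⟨hs, hA, h01⟩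
    have hk := at_symm_zero σ
    have hk0 : (σ.symm 0 : ℕ) ≠ 0 := fun h => by
      rw [h] at hk
      exact absurd (hk.val_unique h01) (by omega)
    have hval : ((2 : Fin (m + 5)) : ℕ) = 2 := rfl
    by_cases hσ : TwoBeforeZero σ
    · have hp : (thirdPos σ : ℕ) = σ.symm 0 + 1 := by simp [thirdPos, hσ]
      obtain ⟨j, hj, hj'⟩ := hσ
      have hjk := hk.pos_unique hj'
      have h01' : At (ins (thirdPos σ) 2 σ) 0 1 := (at_ins_iff (by omega) (by omega)).2 h01
      have hk' : At (ins (thirdPos σ) 2 σ) (j + 1) 0 := (at_ins_iff (by omega) (by omega)).2 hj'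
      have hw' : At (ins (thirdPos σ) 2 σ) j 3 := (at_ins_iff (by omega) (by omega)).2 hj
      obtain ⟨h1, h2, h3, -⟩ := isSimple_insert_third h01' hk' hw' (by omega) (by omega) hs hA
      refine ⟨⟨h1, h2, h01'⟩, fun h => h3 (hw'.pos_unique h), fun h => ?_, j, hk',
        Or.inr ⟨at_ins_self (by omega) rfl, hw'⟩⟩
      have := hk'.pos_unique h
      omega
    · have hp : (thirdPos σ : ℕ) = σ.symm 0 := by simp [thirdPos, hσ]
      obtain ⟨j, hj⟩ := exists_at σ (v := 2) (by omega)
      have hjk : j + 1 ≠ σ.symm 0 := fun h => hσ ⟨j, hj, h ▸ hk⟩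
      have hjk' : j ≠ σ.symm 0 := fun h => by
        rw [h] at hj
        exact absurd (hk.val_unique hj) (by omega)
      have h01' : At (ins (thirdPos σ) 2 σ) 0 1 := (at_ins_iff (by omega) (by omega)).2 h01
      have hk' : At (ins (thirdPos σ) 2 σ) (σ.symm 0 + 1) 0 :=
        (at_ins_iff (by omega) (by omega)).2 hk
      obtain ⟨w, hw, hw'⟩ : ∃ w, ((j < thirdPos σ ∧ w = j) ∨ ((thirdPos σ : ℕ) ≤ j ∧ w = j + 1)) ∧
          At (ins (thirdPos σ) 2 σ) w 3 := by
        rcases lt_or_ge j (thirdPos σ) with h | h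
        · exact ⟨j, by omega, (at_ins_iff (by omega) (by omega)).2 hj⟩
        · exact ⟨j + 1, by omega, (at_ins_iff (by omega) (by omega)).2 hj⟩
      obtain ⟨h1, h2, h3, h4⟩ := isSimple_insert_third h01' hk' hw' (by omega) (by omega) hs hA
      refine ⟨⟨h1, h2, h01'⟩, fun h => h3 (hw'.pos_unique h), fun h => ?_, σ.symm 0, hk',
        Or.inl (at_ins_self (by omega) rfl)⟩
      have := hk'.pos_unique h
      omega
  · rintro π ⟨⟨hs, hA, h01⟩, h13, h20, k, hk, ht⟩
    have hval : ((2 : Fin (m + 5)) : ℕ) = 2 := rfl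
    have hk0 : k ≠ 0 := by
      rintro rfl
      have := (hs.not_adjacent (by omega) h01 hk).2
      omega
    have hk1 : k ≠ 1 := by
      rintro rfl
      exact h20 hk
    rcases ht with ht | ⟨ht, hw⟩
    · obtain ⟨p, σ, hp, rfl⟩ := exists_eq_ins_of_at (v := 2) ht
      have hσ := isSimple_of_insert_third h01 hk h13 (by omega) (by omega) hs hA
      have hk' : At σ k 0 := (at_ins_iff (by omega) (by omega)).1 hk
      have hnot : ¬ TwoBeforeZero σ := by
        rintro ⟨j, hj, hj'⟩
        have hjk := hk'.pos_unique hj'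
        have hj3 : At (ins p 2 σ) j 3 := (at_ins_iff (by omega) (by omega)).2 hj
        rw [hjk] at ht
        exact (hs.not_adjacent (by omega) hj3 ht).2 rfl
      have hpos : thirdPos σ = p := Fin.ext (by
        have := (at_symm_zero σ).pos_unique hk'
        simp [thirdPos, hnot]
        omega)
      exact ⟨σ, hσ, by simp only [hpos]⟩
    · obtain ⟨p, σ, hp, rfl⟩ := exists_eq_ins_of_at (v := 2) ht
      have hσ := isSimple_of_insert_third h01 hk h13 (by omega) (by omega) hs hA
      have hk' : At σ (k + 1) 0 := (at_ins_iff (by omega) (by omega)).1 hk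
      have hw' : At σ k 2 := (at_ins_iff (by omega) (by omega)).1 hw
      have htwo : TwoBeforeZero σ := ⟨k, hw', hk'⟩
      have hpos : thirdPos σ = p := Fin.ext (by
        have := (at_symm_zero σ).pos_unique hk'
        simp [thirdPos, htwo]
        omega)
      exact ⟨σ, hσ, by simp only [hpos]⟩

end Insertion

section Counting

theorem simpleAOne_split (m : ℕ) : simpleAOne (m + 5) =
    ({π | π ∈ simpleAOne (m + 5) ∧ At π 2 0 ∧ ¬ At π 3 2} ∪
      {π | π ∈ simpleAOne (m + 5) ∧ ∃ k, At π k 0 ∧ At π (k + 1) 2 ∧ (k = 2 ∨ At π 1 3)}) ∪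
    ({π | π ∈ simpleAOne (m + 5) ∧ ¬ At π 1 3 ∧ ¬ At π 2 0 ∧
      ∃ k, At π (k + 1) 0 ∧ (At π k 2 ∨ (At π (k + 2) 2 ∧ At π k 3))} ∪
      {π | π ∈ simpleAOne (m + 5) ∧ At π 1 3 ∧ ∃ k, At π k 2 ∧ At π (k + 1) 0}) := by
  apply Set.Subset.antisymm
  swap
  · rintro π ((h | h) | (h | h)) <;> exact h.1
  rintro π hπ
  obtain ⟨hs, hA, h01⟩ := hπ
  obtain ⟨k, hk⟩ := exists_at π (v := 0) (by omega)
  obtain ⟨t, ht⟩ := exists_at π (v := 2) (by omega)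
  obtain ⟨w, hw⟩ := exists_at π (v := 3) (by omega)
  have hk0 : k ≠ 0 := by
    rintro rfl
    exact absurd (hk.val_unique h01) (by omega)
  have hk1 : k ≠ 1 := by
    rintro rfl
    exact (hs.not_adjacent (by omega) h01 hk).2 rfl
  rcases eq_or_ne k 2 with rfl | hk2
  · left
    by_cases h3 : At π 3 2
    · exact Or.inr ⟨⟨hs, hA, h01⟩, 2, hk, h3, Or.inl rfl⟩
    · exact Or.inl ⟨⟨hs, hA, h01⟩, hk, h3⟩
  obtain ⟨o, ho, hπo⟩ := h01.obtain
  obtain ⟨k', rfl, hπk⟩ := hk.obtain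
  obtain ⟨t', rfl, hπt⟩ := ht.obtain
  obtain ⟨w', rfl, hπw⟩ := hw.obtain
  have h20 : ¬ At π 2 0 := fun h => hk2 (hk.pos_unique h)
  rcases hs.shape hA ho hπo hπk hπt hπw (by omega) with h | ⟨h, hcase⟩
  · right
    rw [← h] at hk
    by_cases h13 : At π 1 3
    · exact Or.inr ⟨⟨hs, hA, h01⟩, h13, _, ht, hk⟩
    · exact Or.inl ⟨⟨hs, hA, h01⟩, h13, h20, _, hk, Or.inl ht⟩
  · rw [← h] at ht
    by_cases h13 : At π 1 3
    · exact Or.inl (Or.inr ⟨⟨hs, hA, h01⟩, _, hk, ht, Or.inr h13⟩)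
    · have hw1 : (w' : ℕ) ≠ 1 := fun h => h13 (h ▸ hw)
      have hwk : (w' : ℕ) + 1 = k' := by omega
      rw [← hwk] at hk ht
      exact Or.inr (Or.inl ⟨⟨hs, hA, h01⟩, h13, h20, _, hk, Or.inr ⟨ht, hw⟩⟩)

theorem ncard_simpleAOne_add_five (m : ℕ) : (simpleAOne (m + 5)).ncard =
    2 * (simpleAOne (m + 4)).ncard + (simpleA (m + 3)).ncard + (simpleAOne (m + 3)).ncard := by
  rw [simpleAOne_split, Set.ncard_union_eq, Set.ncard_union_eq, Set.ncard_union_eq,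
    ncard_insert_first, ncard_insert_two_before, ncard_insert_third, ncard_insert_two_after]
  · ring
  · rw [Set.disjoint_left]
    rintro π ⟨-, h13, -⟩ ⟨-, h13', -⟩
    exact h13 h13'
  · rw [Set.disjoint_left]
    rintro π ⟨-, h20, h32⟩ ⟨-, k, hk, ht, -⟩
    obtain rfl := hk.pos_unique h20
    exact h32 ht
  · rw [Set.disjoint_left]
    rintro π (⟨-, h20, h32⟩ | ⟨-, k, hk, ht, hcase⟩) (⟨-, h13, h20', k', hk', ht'⟩ | ⟨-, h13, k', ht', hk'⟩)
    · exact h20' h20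
    · have := hk'.pos_unique h20
      obtain rfl : k' = 1 := by omega
      exact absurd (h13.val_unique ht') (by omega)
    · rcases hcase with rfl | h
      · exact h20' hk
      · exact h13 h
    · have := hk.pos_unique hk'
      have := ht.pos_unique ht'
      omega

theorem IsSimple.first_ne_zero {n : ℕ} {π : Equiv.Perm (Fin n)} (h : IsSimple π) (hn : 2 < n) :
    ¬ At π 0 0 := by
  intro h0
  obtain ⟨x, hx, hx'⟩ := h0.obtain
  obtain ⟨⟨l, -, hl⟩, -⟩ := ((isSimple_iff_simpleOn π).1 h).exists_left_right (t := x)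
    (a := ⟨1, by omega⟩) (b := ⟨2, by omega⟩) trivial trivial trivial (by simp)
    (by rw [Ne, Fin.ext_iff, hx]; simp) (by rw [Ne, Fin.ext_iff, hx]; simp)
    (fun y _ => by rw [Fin.le_def]; omega)
  rw [Fin.lt_def] at hl
  omega

theorem At.symm {n : ℕ} {π : Equiv.Perm (Fin n)} {i v : ℕ} (h : At π i v) : At π.symm v i := by
  obtain ⟨x, hx, hx'⟩ := h.obtain
  exact At.mk (π x) hx' (by rw [Equiv.symm_apply_apply, hx])

theorem ncard_simpleA (m : ℕ) : (simpleA (m + 3)).ncard = 2 * (simpleAOne (m + 3)).ncard := by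
  have hsplit : simpleA (m + 3) = simpleAOne (m + 3) ∪ Equiv.symm '' simpleAOne (m + 3) := by
    ext π
    constructor
    · rintro ⟨hs, hA⟩
      have h0 := hs.first_ne_zero (by omega)
      rcases hs.first_or_second hA (o := 0) (k := π.symm 0) rfl (by simp) with h | h
      · left
        refine ⟨hs, hA, At.mk 0 rfl ?_⟩
        have : (π 0 : ℕ) ≠ 0 := fun h => h0 (At.mk 0 rfl h)
        omega
      · right
        refine ⟨π.symm, ⟨hs.symm, hA.symm, At.mk 0 rfl ?_⟩, Equiv.symm_symm π⟩
        have : (π.symm 0 : ℕ) ≠ 0 := fun h => h0 (At.mk (π.symm 0) h (by simp))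
        omega
    · rintro (h | ⟨σ, h, rfl⟩)
      · exact ⟨h.1, h.2.1⟩
      · exact ⟨h.1.symm, h.2.1.symm⟩
  rw [hsplit, Set.ncard_union_eq, Set.ncard_image_of_injective _ Equiv.symm_bijective.injective,
    two_mul]
  rw [Set.disjoint_left]
  rintro _ h ⟨σ, h', rfl⟩
  exact (h.1.not_adjacent (by omega) h.2.2 h'.2.2.symm).2 rfl

theorem ncard_simpleAOne_three : (simpleAOne 3).ncard = 0 := by
  rw [Set.ncard_eq_zero, Set.eq_empty_iff_forall_notMem]
  rintro π ⟨hs, -, h01⟩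
  obtain ⟨k, hk⟩ := exists_at π (v := 0) (by omega)
  obtain ⟨t, ht⟩ := exists_at π (v := 2) (by omega)
  have hk3 := hk.1
  have ht3 := ht.1
  have hk0 : k ≠ 0 := by
    rintro rfl
    exact absurd (hk.val_unique h01) (by omega)
  have hk1 : k ≠ 1 := by
    rintro rfl
    exact (hs.not_adjacent (by omega) h01 hk).2 rfl
  have ht0 : t ≠ 0 := by
    rintro rfl
    exact absurd (ht.val_unique h01) (by omega)
  have ht1 : t ≠ 1 := by
    rintro rfl
    exact (hs.not_adjacent (by omega) h01 ht).1 rfl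
  obtain rfl : t = k := by omega
  exact absurd (ht.val_unique hk) (by omega)

/-- The permutation 2413 (0-indexed values). -/
noncomputable def p2413 : Equiv.Perm (Fin 4) := Equiv.ofBijective ![1, 3, 0, 2] (by decide)

theorem isSimple_p2413 : IsSimple p2413 := by
  have h : ∀ s : Finset (Fin 4),
      (∀ a b j : Fin 4, (a ∈ s ∧ b ∈ s ∧ a ≤ j ∧ j ≤ b) → j ∈ s) →
      (∀ a b j : Fin 4, (a ∈ s ∧ b ∈ s ∧ p2413 a ≤ p2413 j ∧ p2413 j ≤ p2413 b) → j ∈ s) →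
      s.card ≤ 1 ∨ s = Finset.univ := by
    decide
  exact fun s hs => h s (fun a b j ⟨ha, hb, h1, h2⟩ => hs.1 a ha b hb j h1 h2)
    (fun a b j ⟨ha, hb, h1, h2⟩ => hs.2 a ha b hb j h1 h2)

theorem avoids_of_lt {k n : ℕ} {τ : Equiv.Perm (Fin k)} {π : Equiv.Perm (Fin n)}
    (h : n < k) : Avoids τ π := by
  rintro ⟨f, hf, -⟩
  have := Fintype.card_le_of_injective f hf.injective
  simp only [Fintype.card_fin] at this
  omega

theorem inA_p2413 : InA p2413 := by
  refine ⟨?_, avoids_of_lt (by omega), avoids_of_lt (by omega),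
    avoids_of_lt (by omega)⟩
  rintro ⟨f, hf, h⟩
  have h01 := hf (show (0 : Fin 4) < 1 by decide)
  have h12 := hf (show (1 : Fin 4) < 2 by decide)
  have h23 := hf (show (2 : Fin 4) < 3 by decide)
  rw [Fin.lt_def] at h01 h12 h23
  have h0 : f 0 = 0 := by rw [Fin.ext_iff, Fin.val_zero]; omega
  have h1 : f 1 = 1 := by rw [Fin.ext_iff, Fin.val_one]; omega
  have := h 0 1
  rw [h0, h1] at this
  simp [p4231, p2413] at this

theorem ncard_simpleAOne_four : (simpleAOne 4).ncard = 1 := by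
  rw [Set.ncard_eq_one]
  refine ⟨p2413, Set.eq_singleton_iff_unique_mem.2
    ⟨⟨isSimple_p2413, inA_p2413, At.mk 0 rfl rfl⟩, ?_⟩⟩
  rintro π ⟨hs, -, h01⟩
  have hat : ∀ i : Fin 4, At π i (π i) := fun i => At.mk i rfl rfl
  have h0 : (π 0 : ℕ) = 1 := h01.2
  have a01 := hs.not_adjacent (by omega) (hat 0) (hat 1)
  have a12 := hs.not_adjacent (by omega) (hat 1) (hat 2)
  have a23 := hs.not_adjacent (by omega) (hat 2) (hat 3)
  have d01 := Fin.val_ne_or_eq π 0 1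
  have d02 := Fin.val_ne_or_eq π 0 2
  have d03 := Fin.val_ne_or_eq π 0 3
  have d12 := Fin.val_ne_or_eq π 1 2
  have d13 := Fin.val_ne_or_eq π 1 3
  have d23 := Fin.val_ne_or_eq π 2 3
  simp only [Fin.isValue, Fin.reduceEq, ne_eq, false_or, not_false_eq_true, true_and] at d01 d02 d03 d12 d13 d23
  refine Equiv.ext fun i => Fin.ext ?_
  fin_cases i <;> simp [p2413] <;> omega

theorem four_mul_ncard_simpleAOne (m : ℕ) :
    4 * ((simpleAOne (m + 3)).ncard : ℤ) = 3 ^ m - (-1) ^ m := by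
  induction m using Nat.twoStepInduction with
  | zero => simp [ncard_simpleAOne_three]
  | one => simp [ncard_simpleAOne_four]
  | more m h1 h2 =>
    have h3 := ncard_simpleAOne_add_five m
    rw [ncard_simpleA] at h3
    zify at h3
    rw [show m + 2 + 3 = m + 5 by ring, h3]
    rw [show m + 1 + 3 = m + 4 by ring] at h2
    rw [pow_succ, pow_succ] at h2 ⊢
    linear_combination 2 * h2 + 3 * h1

theorem simpleCount_eq_ncard (n : ℕ) : simpleCount n = (simpleA n).ncard := rfl

end Counting

theorem statement_14 :
    (∀ n : ℕ, 4 ≤ n → 2 * (simpleCount n : ℤ) = 3 ^ (n - 3) + (-1) ^ n) ∧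
    simpleCount 4 = 2 ∧ simpleCount 5 = 4 ∧ simpleCount 6 = 14 ∧
    simpleCount 7 = 40 ∧ simpleCount 8 = 122 ∧ simpleCount 9 = 364 := by
  have h : ∀ n : ℕ, 4 ≤ n → 2 * (simpleCount n : ℤ) = 3 ^ (n - 3) + (-1) ^ n := by
    intro n hn
    obtain ⟨m, rfl⟩ := Nat.exists_eq_add_of_le' (show 3 ≤ n by omega)
    rw [simpleCount_eq_ncard, ncard_simpleA, Nat.add_sub_cancel]
    push_cast
    linear_combination four_mul_ncard_simpleAOne m
  have h4 := h 4 (by norm_num)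
  have h5 := h 5 (by norm_num)
  have h6 := h 6 (by norm_num)
  have h7 := h 7 (by norm_num)
  have h8 := h 8 (by norm_num)
  have h9 := h 9 (by norm_num)
  norm_num at h4 h5 h6 h7 h8 h9
  exact ⟨h, by omega, by omega, by omega, by omega, by omega, by omega⟩
end

section
/- Let σ be a permutation of length m ≥ 1 and τ a permutation of length k ≥ 1, and let σ ⊖ τ be their skew sum. Then σ ⊖ τ ∈ 𝒜 if and only if σ avoids 312 and τ avoids 231. -/
theorem skewSum_castAdd {m k : ℕ} (σ : Equiv.Perm (Fin m)) (τ : Equiv.Perm (Fin k)) (i : Fin m) :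
    (skewSum σ τ (Fin.castAdd k i) : ℕ) = k + σ i := by
  simp [skewSum, Nat.add_comm]

theorem skewSum_natAdd {m k : ℕ} (σ : Equiv.Perm (Fin m)) (τ : Equiv.Perm (Fin k)) (j : Fin k) :
    (skewSum σ τ (Fin.natAdd m j) : ℕ) = τ j := by
  simp [skewSum]

/-- An increasing pair of `σ ⊖ τ` lies entirely in the left or entirely in the right block. -/
theorem lt_of_skewSum_lt {m k : ℕ} {σ : Equiv.Perm (Fin m)} {τ : Equiv.Perm (Fin k)}
    {u v : Fin (m + k)} (h : skewSum σ τ u < skewSum σ τ v) (hu : (u : ℕ) < m) : (v : ℕ) < m := by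
  induction v using Fin.addCases with
  | left j => simp
  | right j =>
    obtain ⟨i, rfl⟩ : ∃ i, u = Fin.castAdd k i := ⟨⟨u, hu⟩, rfl⟩
    rw [Fin.lt_def, skewSum_castAdd, skewSum_natAdd] at h
    omega

theorem contains_p312_iff {n : ℕ} (π : Equiv.Perm (Fin n)) :
    Contains p312 π ↔ ∃ a b c, a < b ∧ b < c ∧ π b < π c ∧ π c < π a := by
  constructor
  · rintro ⟨f, hf, h⟩
    exact ⟨f 0, f 1, f 2, hf (by decide), hf (by decide),
      (h 1 2).1 (by simp [p312]), (h 2 0).1 (by simp [p312])⟩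
  · rintro ⟨a, b, c, hab, hbc, h₁, h₂⟩
    refine ⟨![a, b, c], ?_, ?_⟩
    · simp [Fin.strictMono_iff_lt_succ, Fin.forall_fin_succ, hab, hbc]
    · simp [Fin.forall_fin_succ, p312, h₁, h₂, h₁.le, h₂.le, h₁.trans h₂, (h₁.trans h₂).le]

theorem contains_p231_iff {n : ℕ} (π : Equiv.Perm (Fin n)) :
    Contains p231 π ↔ ∃ a b c, a < b ∧ b < c ∧ π c < π a ∧ π a < π b := by
  constructor
  · rintro ⟨f, hf, h⟩
    exact ⟨f 0, f 1, f 2, hf (by decide), hf (by decide),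
      (h 2 0).1 (by simp [p231]), (h 0 1).1 (by simp [p231])⟩
  · rintro ⟨a, b, c, hab, hbc, h₁, h₂⟩
    refine ⟨![a, b, c], ?_, ?_⟩
    · simp [Fin.strictMono_iff_lt_succ, Fin.forall_fin_succ, hab, hbc]
    · simp [Fin.forall_fin_succ, p231, h₁, h₂, h₁.le, h₂.le, h₁.trans h₂, (h₁.trans h₂).le]

theorem contains_p4231 {n : ℕ} {π : Equiv.Perm (Fin n)} {a b c d : Fin n}
    (hab : a < b) (hbc : b < c) (hcd : c < d) (h₁ : π d < π b) (h₂ : π b < π c) (h₃ : π c < π a) :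
    Contains p4231 π := by
  refine ⟨![a, b, c, d], ?_, ?_⟩
  · simp [Fin.strictMono_iff_lt_succ, Fin.forall_fin_succ, hab, hbc, hcd]
  · have h₁₂ := h₁.trans h₂
    have h₂₃ := h₂.trans h₃
    have h₁₃ := h₁.trans h₂₃
    simp [Fin.forall_fin_succ, p4231, h₁, h₂, h₃, h₁.le, h₂.le, h₃.le, h₁₂, h₂₃, h₁₃, h₁₂.le,
      h₂₃.le, h₁₃.le]

/-- If `σ` avoids 312, then `σ ⊖ τ` has no occurrence of 312 within the left block. -/
theorem Avoids.not_lt_skewSum {m k : ℕ} {σ : Equiv.Perm (Fin m)} (hσ : Avoids p312 σ)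
    (τ : Equiv.Perm (Fin k)) {a b c : Fin (m + k)} (hab : a < b) (hbc : b < c)
    (h₁ : skewSum σ τ b < skewSum σ τ c) (h₂ : skewSum σ τ c < skewSum σ τ a) :
    ¬ (c : ℕ) < m := by
  intro hc
  obtain ⟨c, rfl⟩ : ∃ i, c = Fin.castAdd k i := ⟨⟨c, hc⟩, rfl⟩
  obtain ⟨b, rfl⟩ : ∃ i, b = Fin.castAdd k i := ⟨⟨b, lt_trans hbc hc⟩, rfl⟩
  obtain ⟨a, rfl⟩ : ∃ i, a = Fin.castAdd k i := ⟨⟨a, lt_trans hab (lt_trans hbc hc)⟩, rfl⟩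
  simp only [Fin.lt_def, skewSum_castAdd, Nat.add_lt_add_iff_left] at h₁ h₂
  exact hσ ((contains_p312_iff σ).2 ⟨a, b, c, hab, hbc, h₁, h₂⟩)

/-- If `τ` avoids 231, then `σ ⊖ τ` has no occurrence of 231 within the right block. -/
theorem Avoids.lt_of_skewSum {m k : ℕ} {τ : Equiv.Perm (Fin k)} (hτ : Avoids p231 τ)
    (σ : Equiv.Perm (Fin m)) {a b c : Fin (m + k)} (hab : a < b) (hbc : b < c)
    (h₁ : skewSum σ τ c < skewSum σ τ a) (h₂ : skewSum σ τ a < skewSum σ τ b) :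
    (a : ℕ) < m := by
  induction a using Fin.addCases with
  | left a => simp
  | right a =>
    induction b using Fin.addCases with
    | left b => simp only [Fin.lt_def, Fin.val_natAdd, Fin.val_castAdd] at hab; omega
    | right b =>
      induction c using Fin.addCases with
      | left c => simp only [Fin.lt_def, Fin.val_natAdd, Fin.val_castAdd] at hbc; omega
      | right c =>
        simp only [Fin.lt_def, skewSum_natAdd, Fin.val_natAdd, Nat.add_lt_add_iff_left]
          at hab hbc h₁ h₂
        exact (hτ ((contains_p231_iff τ).2 ⟨a, b, c, hab, hbc, h₁, h₂⟩)).elim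

theorem InA.avoids_left {m k : ℕ} (hk : 1 ≤ k) {σ : Equiv.Perm (Fin m)} {τ : Equiv.Perm (Fin k)}
    (h : InA (skewSum σ τ)) : Avoids p312 σ := by
  intro hc
  obtain ⟨a, b, c, hab, hbc, h₁, h₂⟩ := (contains_p312_iff σ).1 hc
  refine h.1 (contains_p4231 (a := Fin.castAdd k a) (b := Fin.castAdd k b)
    (c := Fin.castAdd k c) (d := Fin.natAdd m ⟨0, hk⟩) hab hbc ?_ ?_ ?_ ?_) <;>
  simp only [Fin.lt_def, skewSum_castAdd, skewSum_natAdd, Fin.val_castAdd, Fin.val_natAdd] at * <;>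
  omega

theorem InA.avoids_right {m k : ℕ} (hm : 1 ≤ m) {σ : Equiv.Perm (Fin m)} {τ : Equiv.Perm (Fin k)}
    (h : InA (skewSum σ τ)) : Avoids p231 τ := by
  intro hc
  obtain ⟨a, b, c, hab, hbc, h₁, h₂⟩ := (contains_p231_iff τ).1 hc
  refine h.1 (contains_p4231 (a := Fin.castAdd k ⟨0, hm⟩) (b := Fin.natAdd m a)
    (c := Fin.natAdd m b) (d := Fin.natAdd m c) ?_ ?_ ?_ ?_ ?_ ?_) <;>
  simp only [Fin.lt_def, skewSum_castAdd, skewSum_natAdd, Fin.val_castAdd, Fin.val_natAdd] at * <;>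
  omega

theorem inA_skewSum {m k : ℕ} {σ : Equiv.Perm (Fin m)} {τ : Equiv.Perm (Fin k)}
    (hσ : Avoids p312 σ) (hτ : Avoids p231 τ) : InA (skewSum σ τ) := by
  refine ⟨?_, ?_, ?_, ?_⟩ <;> rintro ⟨f, hf, h⟩
  · have lt (i j : Fin 4) (hij : p4231 i < p4231 j) := (h i j).1 hij
    have h₁ : (f 1 : ℕ) < m := hτ.lt_of_skewSum σ (hf (by decide : (1 : Fin 4) < 2))
      (hf (by decide : (2 : Fin 4) < 3)) (lt _ _ (by simp [p4231])) (lt _ _ (by simp [p4231]))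
    have h₂ : (f 2 : ℕ) < m := lt_of_skewSum_lt (lt 1 2 (by simp [p4231])) h₁
    exact hσ.not_lt_skewSum τ (hf (by decide : (0 : Fin 4) < 1)) (hf (by decide : (1 : Fin 4) < 2))
      (lt _ _ (by simp [p4231])) (lt _ _ (by simp [p4231])) h₂
  · have lt (i j : Fin 5) (hij : p35142 i < p35142 j) := (h i j).1 hij
    have h₀ : (f 0 : ℕ) < m := hτ.lt_of_skewSum σ (hf (by decide : (0 : Fin 5) < 1))
      (hf (by decide : (1 : Fin 5) < 2)) (lt _ _ (by simp [p35142])) (lt _ _ (by simp [p35142]))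
    have h₃ : (f 3 : ℕ) < m := lt_of_skewSum_lt (lt 0 3 (by simp [p35142])) h₀
    exact hσ.not_lt_skewSum τ (hf (by decide : (1 : Fin 5) < 2)) (hf (by decide : (2 : Fin 5) < 3))
      (lt _ _ (by simp [p35142])) (lt _ _ (by simp [p35142])) h₃
  · have lt (i j : Fin 5) (hij : p42513 i < p42513 j) := (h i j).1 hij
    have h₁ : (f 1 : ℕ) < m := hτ.lt_of_skewSum σ (hf (by decide : (1 : Fin 5) < 2))
      (hf (by decide : (2 : Fin 5) < 3)) (lt _ _ (by simp [p42513])) (lt _ _ (by simp [p42513]))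
    have h₄ : (f 4 : ℕ) < m := lt_of_skewSum_lt (lt 1 4 (by simp [p42513])) h₁
    exact hσ.not_lt_skewSum τ (hf (by decide : (2 : Fin 5) < 3)) (hf (by decide : (3 : Fin 5) < 4))
      (lt _ _ (by simp [p42513])) (lt _ _ (by simp [p42513])) h₄
  · have lt (i j : Fin 6) (hij : p351624 i < p351624 j) := (h i j).1 hij
    have h₀ : (f 0 : ℕ) < m := hτ.lt_of_skewSum σ (hf (by decide : (0 : Fin 6) < 1))
      (hf (by decide : (1 : Fin 6) < 2)) (lt _ _ (by simp [p351624])) (lt _ _ (by simp [p351624]))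
    have h₅ : (f 5 : ℕ) < m := lt_of_skewSum_lt (lt 0 5 (by simp [p351624])) h₀
    exact hσ.not_lt_skewSum τ (hf (by decide : (3 : Fin 6) < 4)) (hf (by decide : (4 : Fin 6) < 5))
      (lt _ _ (by simp [p351624])) (lt _ _ (by simp [p351624])) h₅

theorem statement_17 {m k : ℕ} (hm : 1 ≤ m) (hk : 1 ≤ k)
    (σ : Equiv.Perm (Fin m)) (τ : Equiv.Perm (Fin k)) :
    InA (skewSum σ τ) ↔ Avoids p312 σ ∧ Avoids p231 τ :=
  ⟨fun h => ⟨h.avoids_left hk, h.avoids_right hm⟩, fun h => inA_skewSum h.1 h.2⟩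
end
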